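/- Let $\mathcal V,\mathcal X,\mathcal Y$ be finite alphabets, $P_V$ a probability distribution on $\mathcal V$, $W(y|x)$ a stochastic matrix from $\mathcal X$ to $\mathcal Y$, $P_V^k$ and $W^n$ their product extensions, $t>0$, and let $\mathcal Q=\{Q_1,Q_2\}$ be an (unordered) pair of probability distributions on $\mathcal X$. All logarithms are natural. The type $\hat P_v$ of $v\in\mathcal V^k$ is its empirical distribution and $\mathcal T^k(P)$ is the set of sequences of length $k$ with type $P$. Put $$E_s(\lambda,P_V)=(1+\lambda)\log\sum_{v\in\mathcal V}P_V(v)^{1/(1+\lambda)},\qquad d_B(x,\bar x)=-\log\sum_y\sqrt{W(y|x)W(y|\bar x)}\in[0,+\infty],$$ $$E'_x(Q,\rho)=\min_{Q'}\;-\rho\sum_xQ(x)\log\sum_{\bar x}Q'(\bar x)e^{-d_B(x,\bar x)/\rho},$$ the minimum being over probability distributions $Q'$ on $\mathcal X$ (with $e^{-\infty}=0$, $\log 0=-\infty$, $0\cdot(-\infty)=0$), and $$\bar E'_x(\mathcal Q,\lambda)=\inf_{R\ge0}\,\sup_{\rho\ge1}\Big[\max_{Q\in\mathcal Q}E'_x(Q,\rho)+(\lambda-\rho)R\Big],\qquad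 E^{\mathrm{dual}}_{J,\mathrm{ex}}(t,\mathcal Q)=\sup_{\lambda\ge1}\big\{\bar E'_x(\mathcal Q,\lambda)-tE_s(\lambda,P_V)\big\}\in(-\infty,+\infty].$$ A code of parameters $(k,n)$ is an encoder $f:\mathcal V^k\to\mathcal X^n$ together with a decoder $\varphi:\mathcal Y^n\to\mathcal V^k$; its error probability is $p_e=\sum_vP_V^k(v)\sum_{y:\varphi(y)\ne v}W^n(y|f(v))$. For $R_0>0$ consider the partition of $\mathcal V^k$ into $$\mathcal A_1=\{v:|\mathcal T^k(\hat P_v)|\le e^{nR_0}\},\qquad \mathcal A_2=\{v:|\mathcal T^k(\hat P_v)|>e^{nR_0}\}.$$ For an ordering $(Q_a,Q_b)$ of the pair $\mathcal Q$ and a real $E$, say that this partition with ordering $(Q_a,Q_b)$ *attains* $E$ if for every $\delta>0$ and all sufficiently large $n$, with $k=\lfloor tn\rfloor$, there are types $Q_a',Q_b'$ of sequences in $\mathcal X^n$ with $|Q_a'(x)-Q_a(x)|\le\delta$ and $|Q_b'(x)-Q_b(x)|\le\delta$ for all $x$, and a code of parameters $(k,n)$ with $f(v)\in\mathcal T^n(Q_a')$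 for $v\in\mathcal A_1$, $f(v)\in\mathcal T^n(Q_b')$ for $v\in\mathcal A_2$, and $p_e\le e^{-nE}$. 1. Suppose that for each $Q\in\mathcal Q$ there is a letter $\bar x\in\mathcal X$ with $d_B(x,\bar x)<\infty$ for all $x$ with $Q(x)>0$ (this holds in particular if $d_B$ is finite everywhere). Then there exist a threshold $R_0>0$ and an ordering $(Q_a,Q_b)$ of $\mathcal Q$, depending only on $t,P_V,W,\mathcal Q$, such that the partition with threshold $R_0$ and ordering $(Q_a,Q_b)$ attains every real $E<E^{\mathrm{dual}}_{J,\mathrm{ex}}(t,\mathcal Q)$; that is, it achieves the exponent $E^{\mathrm{dual}}_{J,\mathrm{ex}}(t,\mathcal Q)$. 2. For arbitrary $W$ there is an ordering $(Q_a,Q_b)$ of $\mathcal Q$, depending only on $t,P_V,W,\mathcal Q$, such that for every real $E<E^{\mathrm{dual}}_{J,\mathrm{ex}}(t,\mathcal Q)$ there is a threshold $R_0>0$ for which the partition with threshold $R_0$ and ordering $(Q_a,Q_b)$ attains $E$. -/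

import Mathlib

noncomputable section

/-- Product extension of a distribution: `P^k(v) = ∏ P(vᵢ)`. -/
def prodDist {α : Type*} (P : α → ℝ) {k : ℕ} (v : Fin k → α) : ℝ := ∏ i, P (v i)

/-- Product extension of a channel: `W^n(y|x) = ∏ W(y_l|x_l)`. -/
def Wn {X Y : Type*} (W : X → Y → ℝ) {n : ℕ} (x : Fin n → X) (y : Fin n → Y) : ℝ :=
  ∏ l, W (x l) (y l)

open Classical in
/-- Empirical distribution (type) of a sequence. -/
def empDist {α : Type*} {k : ℕ} (v : Fin k → α) : α → ℝ :=
  fun a => ((Finset.univ.filter fun i => v i = a).card : ℝ) / k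

open Classical in
/-- Type class `T^k(P)`: sequences of length `k` with empirical distribution `P`. -/
def typeClass {α : Type*} [Fintype α] (k : ℕ) (P : α → ℝ) : Finset (Fin k → α) :=
  Finset.univ.filter fun v => empDist v = P

/-- `P` is a type of length-`k` sequences, i.e. `P ∈ 𝒫ₖ(α)`. -/
def IsType {α : Type*} (k : ℕ) (P : α → ℝ) : Prop :=
  ∃ v : Fin k → α, empDist v = P

open Classical in
/-- Error probability of a joint source-channel code with encoder `f` and decoder `φ`. -/
def pErr {V X Y : Type*} [Fintype V] [Fintype Y] (PV : V → ℝ)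
    (W : X → Y → ℝ) {k n : ℕ}
    (f : (Fin k → V) → Fin n → X) (φ : (Fin n → Y) → Fin k → V) : ℝ :=
  ∑ v : Fin k → V, prodDist PV v *
    ∑ y ∈ Finset.univ.filter (fun y : Fin n → Y => φ y ≠ v), Wn W (f v) y

/-- Source function `E_s(ρ, P_V) = (1 + ρ) log ∑ P_V(v)^{1/(1+ρ)}`. -/
def Es {V : Type*} [Fintype V] (PV : V → ℝ) (ρ : ℝ) : ℝ :=
  (1 + ρ) * Real.log (∑ v, PV v ^ (1 / (1 + ρ)))

/-- Bhattacharyya distance `d_B(x, x̄) = -log ∑_y √(W(y|x) W(y|x̄)) ∈ [0, +∞]`; it is `+∞`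
exactly when no output letter can be reached from both `x` and `x̄`. -/
def dB {X Y : Type*} [Fintype Y] (W : X → Y → ℝ) (x x' : X) : EReal :=
  -ENNReal.log (ENNReal.ofReal (∑ y, Real.sqrt (W x y * W x' y)))

/-- Dual weak expurgated function
`E'_x(Q, ρ) = min_{Q'} -ρ ∑_x Q(x) log ∑_x̄ Q'(x̄) e^{-d_B(x, x̄)/ρ}`, computed with
`e^{-∞} = 0`, `log 0 = -∞` and `0 · (-∞) = 0`. -/
def Ex' {X Y : Type*} [Fintype X] [Fintype Y] (W : X → Y → ℝ) (Q : X → ℝ) (ρ : ℝ) : EReal :=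
  ⨅ Q' ∈ stdSimplex ℝ X,
    (-ρ : EReal) * ∑ x, (Q x : EReal) *
      ENNReal.log (∑ x', ENNReal.ofReal (Q' x') * EReal.exp (-(dB W x x') / (ρ : EReal)))

/-- `Ē'_x(𝒬, λ) = inf_{R ≥ 0} sup_{ρ ≥ 1} [max_{Q ∈ 𝒬} E'_x(Q, ρ) + (λ - ρ) R]`. -/
def ExBar {X Y : Type*} [Fintype X] [Fintype Y] (W : X → Y → ℝ) (𝒬 : Set (X → ℝ))
    (lam : ℝ) : EReal :=
  ⨅ R ∈ Set.Ici (0 : ℝ), ⨆ ρ ∈ Set.Ici (1 : ℝ),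
    ((⨆ Q ∈ 𝒬, Ex' W Q ρ) + (((lam - ρ) * R : ℝ) : EReal))

/-- The dual exponent `E^dual_{J,ex}(t, 𝒬) = sup_{λ ≥ 1} {Ē'_x(𝒬, λ) - t E_s(λ, P_V)}`. -/
def EJexDual {V X Y : Type*} [Fintype V] [Fintype X] [Fintype Y]
    (PV : V → ℝ) (W : X → Y → ℝ) (t : ℝ) (𝒬 : Set (X → ℝ)) : EReal :=
  ⨆ lam ∈ Set.Ici (1 : ℝ), (ExBar W 𝒬 lam - ((t * Es PV lam : ℝ) : EReal))

/-- The class `𝒜₁ = {v ∈ 𝒱^k : |T^k(P̂_v)| ≤ e^{nR₀}}`; the class `𝒜₂` is its complement. -/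
def lowClass (V : Type*) [Fintype V] (k n : ℕ) (R₀ : ℝ) : Set (Fin k → V) :=
  {v | ((typeClass k (empDist v)).card : ℝ) ≤ Real.exp (n * R₀)}

/-- The two-class partition with threshold `R₀`, with codewords of `𝒜₁` taken from a type class
of composition approximating `Qa` and codewords of `𝒜₂` from one of composition approximating
`Qb`, attains the error bound `p_e ≤ e^{-nE}` for all large `n`, with `k = ⌊tn⌋`, however close
the approximation of `Qa` and `Qb` is required to be. -/
def TwoClassAttains {V X Y : Type*} [Fintype V] [Fintype X] [Fintype Y]
    (PV : V → ℝ) (W : X → Y → ℝ) (t : ℝ) (Qa Qb : X → ℝ) (R₀ E : ℝ) : Prop :=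
  ∀ δ : ℝ, 0 < δ → ∃ n₀ : ℕ, ∀ n : ℕ, n₀ ≤ n →
    ∃ Qa' Qb' : X → ℝ, IsType n Qa' ∧ IsType n Qb' ∧
      (∀ x, |Qa' x - Qa x| ≤ δ) ∧ (∀ x, |Qb' x - Qb x| ≤ δ) ∧
      ∃ (f : (Fin ⌊t * (n : ℝ)⌋₊ → V) → Fin n → X)
        (φ : (Fin n → Y) → Fin ⌊t * (n : ℝ)⌋₊ → V),
        (∀ v ∈ lowClass V ⌊t * (n : ℝ)⌋₊ n R₀, f v ∈ typeClass n Qa') ∧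
        (∀ v ∉ lowClass V ⌊t * (n : ℝ)⌋₊ n R₀, f v ∈ typeClass n Qb') ∧
        pErr PV W f φ ≤ Real.exp (-(n * E))

end

noncomputable section

section Bhattacharyya

variable {X Y : Type*} [Fintype Y]

/-- Bhattacharyya coefficient `∑_y √(W(y|x) W(y|x'))`, that is `e^{-d_B(x, x')}`. -/
def bhatt (W : X → Y → ℝ) (x x' : X) : ℝ := ∑ y, Real.sqrt (W x y * W x' y)

lemma bhatt_nonneg (W : X → Y → ℝ) (x x' : X) : 0 ≤ bhatt W x x' :=
  Finset.sum_nonneg fun _ _ => Real.sqrt_nonneg _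

lemma bhatt_comm (W : X → Y → ℝ) (x x' : X) : bhatt W x x' = bhatt W x' x := by
  unfold bhatt
  simp_rw [mul_comm]

lemma bhatt_self {W : X → Y → ℝ} (hW : ∀ x, W x ∈ stdSimplex ℝ Y) (x : X) :
    bhatt W x x = 1 := by
  unfold bhatt
  rw [← (hW x).2]
  exact Finset.sum_congr rfl fun y _ => Real.sqrt_mul_self ((hW x).1 y)

lemma bhatt_le_one {W : X → Y → ℝ} (hW : ∀ x, W x ∈ stdSimplex ℝ Y) (x x' : X) :
    bhatt W x x' ≤ 1 := by
  have h : ∀ y, Real.sqrt (W x y * W x' y) ≤ (W x y + W x' y) / 2 := by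
    intro y
    have h1 := (hW x).1 y
    have h2 := (hW x').1 y
    rw [Real.sqrt_le_left (by positivity)]
    nlinarith [sq_nonneg (W x y - W x' y)]
  calc bhatt W x x' ≤ ∑ y, (W x y + W x' y) / 2 := Finset.sum_le_sum fun y _ => h y
    _ = 1 := by
      rw [← Finset.sum_div, Finset.sum_add_distrib, (hW x).2, (hW x').2]; norm_num

lemma bhatt_pos_of_dB_ne_top {W : X → Y → ℝ} {x x' : X} (h : dB W x x' ≠ ⊤) :
    0 < bhatt W x x' := by
  by_contra h0
  apply h
  unfold dB
  unfold bhatt at h0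
  rw [ENNReal.ofReal_of_nonpos (not_lt.mp h0)]
  simp

lemma exp_neg_dB_div (W : X → Y → ℝ) (x x' : X) {ρ : ℝ} (hρ : 0 < ρ) :
    EReal.exp (-(dB W x x') / (ρ : EReal)) = ENNReal.ofReal (bhatt W x x' ^ (1 / ρ)) := by
  unfold dB
  rw [neg_neg, div_eq_mul_inv, ← EReal.coe_inv, EReal.exp_mul, ENNReal.exp_log, ← one_div,
    ENNReal.ofReal_rpow_of_nonneg (Finset.sum_nonneg fun _ _ => Real.sqrt_nonneg _)
      (by positivity)]
  rfl

variable [Fintype X]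

/-- The inner sum `∑_x' q(x') e^{-d_B(x, x')/ρ}`. -/
def tiltedBhatt (W : X → Y → ℝ) (q : X → ℝ) (ρ : ℝ) (x : X) : ℝ :=
  ∑ x', q x' * bhatt W x x' ^ (1 / ρ)

lemma tiltedBhatt_nonneg (W : X → Y → ℝ) {q : X → ℝ} (hq : q ∈ stdSimplex ℝ X) (ρ : ℝ) (x : X) :
    0 ≤ tiltedBhatt W q ρ x :=
  Finset.sum_nonneg fun x' _ => mul_nonneg (hq.1 x') (Real.rpow_nonneg (bhatt_nonneg _ _ _) _)

lemma tiltedBhatt_le_one {W : X → Y → ℝ} (hW : ∀ x, W x ∈ stdSimplex ℝ Y) {q : X → ℝ}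
    (hq : q ∈ stdSimplex ℝ X) {ρ : ℝ} (hρ : 0 < ρ) (x : X) : tiltedBhatt W q ρ x ≤ 1 := by
  rw [← hq.2]
  refine Finset.sum_le_sum fun x' _ => ?_
  exact mul_le_of_le_one_right (hq.1 x')
    (Real.rpow_le_one (bhatt_nonneg _ _ _) (bhatt_le_one hW _ _) (by positivity))

lemma sum_ofReal_mul_exp_eq (W : X → Y → ℝ) {q : X → ℝ} (hq : q ∈ stdSimplex ℝ X) {ρ : ℝ}
    (hρ : 0 < ρ) (x : X) :
    ∑ x', ENNReal.ofReal (q x') * EReal.exp (-(dB W x x') / (ρ : EReal))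
      = ENNReal.ofReal (tiltedBhatt W q ρ x) := by
  unfold tiltedBhatt
  rw [ENNReal.ofReal_sum_of_nonneg fun x' _ =>
    mul_nonneg (hq.1 x') (Real.rpow_nonneg (bhatt_nonneg _ _ _) _)]
  refine Finset.sum_congr rfl fun x' _ => ?_
  rw [exp_neg_dB_div W x x' hρ, ENNReal.ofReal_mul (hq.1 x')]

lemma Ex'_nonneg {W : X → Y → ℝ} (hW : ∀ x, W x ∈ stdSimplex ℝ Y) {Q : X → ℝ}
    (hQ : Q ∈ stdSimplex ℝ X) {ρ : ℝ} (hρ : 0 < ρ) : 0 ≤ Ex' W Q ρ := by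
  refine le_iInf₂ fun q hq => ?_
  refine EReal.mul_nonneg_iff.2 (Or.inr ⟨?_, ?_⟩)
  · rw [← EReal.coe_neg]
    exact_mod_cast neg_nonpos.2 hρ.le
  · refine Finset.sum_nonpos fun x _ => EReal.mul_nonpos_iff.2 (Or.inl ⟨?_, ?_⟩)
    · exact_mod_cast hQ.1 x
    · rw [sum_ofReal_mul_exp_eq W hq hρ, ENNReal.log_le_zero_iff]
      exact ENNReal.ofReal_le_one.2 (tiltedBhatt_le_one hW hq hρ x)

lemma EReal.coe_sum_real {ι : Type*} (s : Finset ι) (f : ι → ℝ) :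
    ((∑ i ∈ s, f i : ℝ) : EReal) = ∑ i ∈ s, (f i : EReal) := by
  classical
  induction s using Finset.induction_on with
  | empty => simp
  | insert a s ha ih => rw [Finset.sum_insert ha, Finset.sum_insert ha, EReal.coe_add, ih]

lemma Ex'_le {W : X → Y → ℝ} {Q q : X → ℝ} (hq : q ∈ stdSimplex ℝ X) {ρ : ℝ} (hρ : 0 < ρ)
    (hpos : ∀ x, Q x ≠ 0 → 0 < tiltedBhatt W q ρ x) :
    Ex' W Q ρ ≤ ((-ρ * ∑ x, Q x * Real.log (tiltedBhatt W q ρ x) : ℝ) : EReal) := by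
  refine (iInf₂_le q hq).trans (le_of_eq ?_)
  rw [EReal.coe_mul, EReal.coe_neg, EReal.coe_sum_real]
  congr 1
  refine Finset.sum_congr rfl fun x _ => ?_
  rw [sum_ofReal_mul_exp_eq W hq hρ]
  by_cases hx : Q x = 0
  · simp [hx]
  · rw [ENNReal.log_ofReal_of_pos (hpos x hx), EReal.coe_mul]

/-- The real value of the dual weak expurgated function, which is always finite. -/
def exReal (W : X → Y → ℝ) (Q : X → ℝ) (ρ : ℝ) : ℝ := (Ex' W Q ρ).toReal

lemma Ex'_le_mul_log_card {W : X → Y → ℝ} (hW : ∀ x, W x ∈ stdSimplex ℝ Y) {Q : X → ℝ}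
    (hQ : Q ∈ stdSimplex ℝ X) {ρ : ℝ} (hρ : 0 < ρ) :
    Ex' W Q ρ ≤ ((ρ * Real.log (Fintype.card X) : ℝ) : EReal) := by
  have hne : Nonempty X := by
    by_contra h
    rw [not_nonempty_iff] at h
    simpa using hQ.2
  have hc : (0 : ℝ) < Fintype.card X := by exact_mod_cast Fintype.card_pos
  have hq : (fun _ : X => (1 : ℝ) / Fintype.card X) ∈ stdSimplex ℝ X :=
    ⟨fun _ => by positivity, by simp [hc.ne']⟩
  have hlow : ∀ x, (1 : ℝ) / Fintype.card X ≤
      tiltedBhatt W (fun _ : X => (1 : ℝ) / Fintype.card X) ρ x := by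
    intro x
    unfold tiltedBhatt
    have := Finset.single_le_sum
      (f := fun x' => (1 : ℝ) / Fintype.card X * bhatt W x x' ^ (1 / ρ))
      (fun x' _ => mul_nonneg (by positivity) (Real.rpow_nonneg (bhatt_nonneg _ _ _) _))
      (Finset.mem_univ x)
    simpa [bhatt_self hW] using this
  have hpos : ∀ x, 0 < tiltedBhatt W (fun _ : X => (1 : ℝ) / Fintype.card X) ρ x :=
    fun x => lt_of_lt_of_le (by positivity) (hlow x)
  refine (Ex'_le hq hρ fun x _ => hpos x).trans (EReal.coe_le_coe_iff.2 ?_)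
  have h1 : -Real.log (Fintype.card X) ≤
      ∑ x, Q x * Real.log (tiltedBhatt W (fun _ : X => (1 : ℝ) / Fintype.card X) ρ x) := by
    calc -Real.log (Fintype.card X) = ∑ x, Q x * -Real.log (Fintype.card X) := by
          rw [← Finset.sum_mul, hQ.2, one_mul]
      _ ≤ _ := Finset.sum_le_sum fun x _ => by
          refine mul_le_mul_of_nonneg_left ?_ (hQ.1 x)
          have := Real.log_le_log (by positivity) (hlow x)
          rwa [one_div, Real.log_inv, ← one_div] at this
  nlinarith

lemma coe_exReal {W : X → Y → ℝ} (hW : ∀ x, W x ∈ stdSimplex ℝ Y) {Q : X → ℝ}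
    (hQ : Q ∈ stdSimplex ℝ X) {ρ : ℝ} (hρ : 0 < ρ) : (exReal W Q ρ : EReal) = Ex' W Q ρ := by
  refine EReal.coe_toReal (ne_top_of_le_ne_top (EReal.coe_ne_top _)
    (Ex'_le_mul_log_card hW hQ hρ)) ?_
  exact ne_bot_of_le_ne_bot EReal.zero_ne_bot (Ex'_nonneg hW hQ hρ)

lemma exReal_le_mul_log_card {W : X → Y → ℝ} (hW : ∀ x, W x ∈ stdSimplex ℝ Y) {Q : X → ℝ}
    (hQ : Q ∈ stdSimplex ℝ X) {ρ : ℝ} (hρ : 0 < ρ) :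
    exReal W Q ρ ≤ ρ * Real.log (Fintype.card X) := by
  have := Ex'_le_mul_log_card hW hQ hρ
  rw [← coe_exReal hW hQ hρ] at this
  exact_mod_cast this

lemma exReal_le_of_bhatt_pos {W : X → Y → ℝ} (hW : ∀ x, W x ∈ stdSimplex ℝ Y) {Q : X → ℝ}
    (hQ : Q ∈ stdSimplex ℝ X) {x' : X} (hx' : ∀ x, Q x ≠ 0 → 0 < bhatt W x x') {ρ : ℝ}
    (hρ : 0 < ρ) : exReal W Q ρ ≤ -∑ x, Q x * Real.log (bhatt W x x') := by
  classical
  have hq : (Pi.single x' 1 : X → ℝ) ∈ stdSimplex ℝ X := single_mem_stdSimplex ℝ x'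
  have hval : ∀ x, tiltedBhatt W (Pi.single x' 1) ρ x = bhatt W x x' ^ (1 / ρ) := by
    intro x
    unfold tiltedBhatt
    simp [Pi.single_apply]
  have h := Ex'_le (W := W) (Q := Q) hq hρ fun x hx => by
    rw [hval]; exact Real.rpow_pos_of_pos (hx' x hx) _
  rw [← coe_exReal hW hQ hρ, EReal.coe_le_coe_iff] at h
  refine h.trans (le_of_eq ?_)
  rw [neg_mul, Finset.mul_sum]
  congr 1
  refine Finset.sum_congr rfl fun x _ => ?_
  by_cases hx : Q x = 0
  · simp [hx]
  · rw [hval, Real.log_rpow (hx' x hx)]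
    field_simp

/-- A sequence whose composition dominates `(1 - ε) Q` has a small product of inner sums, whatever
the reference distribution `q`. -/
lemma prod_tiltedBhatt_le {W : X → Y → ℝ} (hW : ∀ x, W x ∈ stdSimplex ℝ Y) {Q q : X → ℝ}
    (hQ : Q ∈ stdSimplex ℝ X) (hq : q ∈ stdSimplex ℝ X) {ρ ε : ℝ} (hρ : 0 < ρ) (hε1 : ε < 1)
    {n : ℕ} (hn : 0 < n) (x : Fin n → X) (hx : ∀ a, (1 - ε) * Q a ≤ empDist x a) :
    ∏ l, tiltedBhatt W q ρ (x l) ≤ Real.exp (-(n * ((1 - ε) * exReal W Q ρ) / ρ)) := by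
  classical
  have hn' : (0 : ℝ) < n := by exact_mod_cast hn
  have hprod : ∏ l, tiltedBhatt W q ρ (x l)
      = ∏ a, tiltedBhatt W q ρ a ^ (Finset.univ.filter fun i => x i = a).card := by
    rw [← Finset.prod_fiberwise_of_maps_to (s := Finset.univ) (t := Finset.univ) (g := x)
      (fun _ _ => Finset.mem_univ _)]
    refine Finset.prod_congr rfl fun a _ => ?_
    rw [← Finset.prod_const]
    refine Finset.prod_congr rfl fun i hi => ?_
    rw [(Finset.mem_filter.1 hi).2]
  have hcard : ∀ a, ((Finset.univ.filter fun i => x i = a).card : ℝ) = n * empDist x a := by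
    intro a
    unfold empDist
    rw [mul_div_cancel₀ _ hn'.ne']
  by_cases hpos : ∀ a, Q a ≠ 0 → 0 < tiltedBhatt W q ρ a
  · have h := Ex'_le (W := W) (Q := Q) hq hρ hpos
    rw [← coe_exReal hW hQ hρ, EReal.coe_le_coe_iff] at h
    have hstep : ∏ l, tiltedBhatt W q ρ (x l) ≤
        ∏ a, Real.exp (n * ((1 - ε) * (Q a * Real.log (tiltedBhatt W q ρ a)))) := by
      rw [hprod]
      refine Finset.prod_le_prod (fun a _ => pow_nonneg (tiltedBhatt_nonneg W hq ρ a) _)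
        fun a _ => ?_
      by_cases ha : Q a = 0
      · simp only [ha, zero_mul, mul_zero, Real.exp_zero]
        exact pow_le_one₀ (tiltedBhatt_nonneg W hq ρ a) (tiltedBhatt_le_one hW hq hρ a)
      · have hp := hpos a ha
        rw [← Real.exp_log (pow_pos hp _), Real.log_pow, hcard]
        apply Real.exp_le_exp.2
        have hlog : Real.log (tiltedBhatt W q ρ a) ≤ 0 :=
          Real.log_nonpos hp.le (tiltedBhatt_le_one hW hq hρ a)
        have := mul_le_mul_of_nonpos_right (hx a) hlog
        calc n * empDist x a * Real.log (tiltedBhatt W q ρ a)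
            = n * (empDist x a * Real.log (tiltedBhatt W q ρ a)) := by ring
          _ ≤ n * ((1 - ε) * Q a * Real.log (tiltedBhatt W q ρ a)) :=
            mul_le_mul_of_nonneg_left this hn'.le
          _ = _ := by ring
    refine hstep.trans ?_
    rw [← Real.exp_sum, ← Finset.mul_sum, ← Finset.mul_sum]
    apply Real.exp_le_exp.2
    have h2 : ∑ a, Q a * Real.log (tiltedBhatt W q ρ a) ≤ -(exReal W Q ρ / ρ) := by
      rw [le_neg, div_le_iff₀ hρ]
      linarith
    have h3 := mul_le_mul_of_nonneg_left h2 (mul_nonneg hn'.le (sub_nonneg.2 hε1.le))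
    calc _ = n * (1 - ε) * ∑ a, Q a * Real.log (tiltedBhatt W q ρ a) := by ring
      _ ≤ _ := h3
      _ = _ := by ring
  · push Not at hpos
    obtain ⟨a, ha, ha0⟩ := hpos
    have ha1 : tiltedBhatt W q ρ a = 0 := le_antisymm ha0 (tiltedBhatt_nonneg W hq ρ a)
    have hQa : 0 < Q a := lt_of_le_of_ne (hQ.1 a) (Ne.symm ha)
    have he : 0 < empDist x a := lt_of_lt_of_le (mul_pos (sub_pos.2 hε1) hQa) (hx a)
    rw [hprod, Finset.prod_eq_zero (Finset.mem_univ a)]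
    · positivity
    · rw [ha1, zero_pow]
      intro h0
      have h1 := hcard a
      rw [h0, Nat.cast_zero] at h1
      have := mul_pos hn' he
      linarith

end Bhattacharyya

section Permutations

open Finset

lemma factorial_mul_exp_le (m : ℕ) :
    (m.factorial : ℝ) * Real.exp m ≤ Real.exp 1 * max (m : ℝ) 1 * (m : ℝ) ^ m := by
  rcases Nat.eq_zero_or_pos m with rfl | hm
  · simp
  induction m, hm using Nat.le_induction with
  | base => simp
  | succ m hm ih =>
    have hm0 : (0 : ℝ) < m := by exact_mod_cast hm
    have hmax : max (m : ℝ) 1 = m := max_eq_left (by exact_mod_cast hm)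
    have hmax' : max ((m + 1 : ℕ) : ℝ) 1 = m + 1 := by
      rw [Nat.cast_add_one]; exact max_eq_left (by linarith)
    have hkey : Real.exp 1 * (m : ℝ) ^ (m + 1) ≤ ((m : ℝ) + 1) ^ (m + 1) := by
      have h1 : Real.exp (1 / ((m : ℝ) + 1)) ≤ ((m : ℝ) + 1) / m := by
        rw [← Real.le_log_iff_exp_le (by positivity)]
        have := Real.one_sub_inv_le_log_of_pos (x := ((m : ℝ) + 1) / m) (by positivity)
        refine le_trans (le_of_eq ?_) this
        field_simp
        ring
      have h2 := pow_le_pow_left₀ (Real.exp_pos _).le h1 (m + 1)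
      rw [← Real.exp_nat_mul, div_pow, le_div_iff₀ (by positivity)] at h2
      have h3 : ((m + 1 : ℕ) : ℝ) * (1 / ((m : ℝ) + 1)) = 1 := by
        push_cast
        field_simp
      rwa [h3] at h2
    rw [hmax] at ih
    rw [hmax', Nat.factorial_succ]
    push_cast
    calc ((m : ℝ) + 1) * m.factorial * Real.exp (m + 1)
        = (m + 1) * Real.exp 1 * (m.factorial * Real.exp m) := by rw [Real.exp_add]; ring
      _ ≤ (m + 1) * Real.exp 1 * (Real.exp 1 * m * (m : ℝ) ^ m) := by gcongr
      _ = (m + 1) * Real.exp 1 * (Real.exp 1 * (m : ℝ) ^ (m + 1)) := by ring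
      _ ≤ (m + 1) * Real.exp 1 * (((m : ℝ) + 1) ^ (m + 1)) := by gcongr
      _ = _ := by ring

lemma card_perm_comp_eq_le {ι X : Type*} [Fintype ι] [DecidableEq ι] [Fintype X] [DecidableEq X]
    (x₀ x : ι → X) :
    (univ.filter fun σ : Equiv.Perm ι => x₀ ∘ σ = x).card
      ≤ ∏ a, (univ.filter fun i => x₀ i = a).card.factorial := by
  rcases (univ.filter fun σ : Equiv.Perm ι => x₀ ∘ σ = x).eq_empty_or_nonempty with h | ⟨τ, hτ⟩
  · rw [h]; simp
  · have hτ' := (mem_filter.1 hτ).2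
    have hstab := DomMulAct.stabilizer_card x₀
    simp only [Fintype.card_subtype] at hstab
    rw [← hstab]
    refine card_le_card_of_injOn (fun σ => σ * τ⁻¹) ?_ ?_
    · intro σ hσ
      have hσ' := (mem_filter.1 hσ).2
      simp only [coe_filter, mem_univ, true_and, Set.mem_ofPred_eq]
      funext i
      have h1 := congrFun hσ' (τ⁻¹ i)
      have h2 := congrFun hτ' (τ⁻¹ i)
      have h3 : τ (τ⁻¹ i) = i := τ.apply_symm_apply i
      simp only [Function.comp_apply, Equiv.Perm.mul_apply] at *
      rw [h1, ← h2, h3]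
    · intro σ _ σ' _ h
      simpa using h

lemma sum_card_fiber {n : ℕ} {X : Type*} [Fintype X] [DecidableEq X] (x : Fin n → X) :
    ∑ a, (univ.filter fun i => x i = a).card = n := by
  have := card_eq_sum_card_fiberwise (s := (univ : Finset (Fin n))) (t := univ) (f := x)
    (fun _ _ => mem_univ _)
  simpa using this.symm

lemma prod_factorial_le {n : ℕ} (hn : 0 < n) {X : Type*} [Fintype X] [DecidableEq X]
    (x : Fin n → X) :
    ∏ a, ((univ.filter fun i => x i = a).card.factorial : ℝ)
      ≤ n.factorial * (Real.exp 1 * n) ^ Fintype.card X *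
        ∏ a, empDist x a ^ (univ.filter fun i => x i = a).card := by
  have hn' : (0 : ℝ) < n := by exact_mod_cast hn
  set m : X → ℕ := fun a => (univ.filter fun i => x i = a).card with hm
  have hsum : ∑ a, m a = n := sum_card_fiber x
  have hemp : ∀ a, empDist x a = m a / n := by
    intro a
    simp only [empDist, hm]
    congr!
  have hle : ∀ a, m a ≤ n := fun a => hsum ▸ single_le_sum (fun _ _ => Nat.zero_le _) (mem_univ a)
  have h1 : (∏ a, ((m a).factorial : ℝ)) * Real.exp n
      ≤ (Real.exp 1 * n) ^ Fintype.card X * ∏ a, (m a : ℝ) ^ m a := by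
    calc (∏ a, ((m a).factorial : ℝ)) * Real.exp n
        = ∏ a, (((m a).factorial : ℝ) * Real.exp (m a)) := by
          rw [prod_mul_distrib, ← Real.exp_sum, ← Nat.cast_sum, hsum]
      _ ≤ ∏ a, (Real.exp 1 * n * (m a : ℝ) ^ m a) := by
          refine prod_le_prod (fun a _ => by positivity) fun a _ => ?_
          refine (factorial_mul_exp_le (m a)).trans ?_
          have : max (m a : ℝ) 1 ≤ n :=
            max_le (by exact_mod_cast hle a) (by exact_mod_cast hn)
          gcongr
      _ = _ := by rw [prod_mul_distrib, prod_const, card_univ]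
  have h2 : (n : ℝ) ^ n ≤ n.factorial * Real.exp n := by
    have := Real.pow_div_factorial_le_exp (n : ℝ) hn'.le n
    rw [div_le_iff₀ (by positivity)] at this
    linarith
  have h3 : ∏ a, empDist x a ^ m a = (∏ a, (m a : ℝ) ^ m a) / n ^ n := by
    simp_rw [hemp, div_pow]
    rw [prod_div_distrib, prod_pow_eq_pow_sum, hsum]
  rw [h3, mul_div_assoc', le_div_iff₀ (by positivity)]
  have hp : 0 ≤ ∏ a, ((m a).factorial : ℝ) := prod_nonneg fun _ _ => by positivity
  calc (∏ a, ((m a).factorial : ℝ)) * (n : ℝ) ^ n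
      ≤ (∏ a, ((m a).factorial : ℝ)) * (n.factorial * Real.exp n) := by gcongr
    _ = n.factorial * ((∏ a, ((m a).factorial : ℝ)) * Real.exp n) := by ring
    _ ≤ n.factorial * ((Real.exp 1 * n) ^ Fintype.card X * ∏ a, (m a : ℝ) ^ m a) := by gcongr
    _ = _ := by ring

lemma empDist_nonneg {n : ℕ} {X : Type*} (x : Fin n → X) (a : X) : 0 ≤ empDist x a := by
  unfold empDist; positivity

lemma empDist_mem_stdSimplex {n : ℕ} (hn : 0 < n) {X : Type*} [Fintype X] (x : Fin n → X) :
    empDist x ∈ stdSimplex ℝ X := by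
  classical
  refine ⟨empDist_nonneg x, ?_⟩
  have hn' : (n : ℝ) ≠ 0 := by exact_mod_cast hn.ne'
  have := sum_card_fiber x
  unfold empDist
  rw [← sum_div, ← Nat.cast_sum, div_eq_one_iff_eq hn']
  convert congrArg (Nat.cast : ℕ → ℝ) this

/-- The average over all rearrangements of `x₀` of a product of nonnegative functions is, up to a
polynomial factor, at most the average over independent letters with the composition of `x₀`. -/
lemma sum_perm_prod_le {n : ℕ} (hn : 0 < n) {X : Type*} [Fintype X] (x₀ : Fin n → X)
    (g : Fin n → X → ℝ) (hg : ∀ l a, 0 ≤ g l a) :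
    ∑ σ : Equiv.Perm (Fin n), ∏ l, g l (x₀ (σ l)) ≤
      n.factorial * (Real.exp 1 * n) ^ Fintype.card X * ∏ l, ∑ a, empDist x₀ a * g l a := by
  classical
  set F : ℝ := ∏ a, ((univ.filter fun i => x₀ i = a).card.factorial : ℝ) with hF
  have hC : (0 : ℝ) ≤ n.factorial * (Real.exp 1 * n) ^ Fintype.card X := by positivity
  have hpd : ∀ σ : Equiv.Perm (Fin n), ∏ l, empDist x₀ (x₀ (σ l))
      = ∏ a, empDist x₀ a ^ (univ.filter fun i => x₀ i = a).card := by
    intro σ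
    rw [Equiv.prod_comp σ (fun l => empDist x₀ (x₀ l)),
      ← prod_fiberwise_of_maps_to (s := univ) (t := univ) (g := x₀) (fun _ _ => mem_univ _)]
    refine prod_congr rfl fun a _ => ?_
    rw [← prod_const]
    exact prod_congr rfl fun i hi => by rw [(mem_filter.1 hi).2]
  calc ∑ σ : Equiv.Perm (Fin n), ∏ l, g l (x₀ (σ l))
      = ∑ x : Fin n → X, ∑ σ ∈ univ.filter (fun σ : Equiv.Perm (Fin n) => x₀ ∘ σ = x),
          ∏ l, g l (x₀ (σ l)) := by
        rw [sum_fiberwise_of_maps_to (t := univ) (fun _ _ => mem_univ _)]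
    _ ≤ ∑ x : Fin n → X, n.factorial * (Real.exp 1 * n) ^ Fintype.card X *
          ∏ l, (empDist x₀ (x l) * g l (x l)) := by
        refine sum_le_sum fun x _ => ?_
        have hgx : 0 ≤ ∏ l, g l (x l) := prod_nonneg fun l _ => hg _ _
        rcases (univ.filter fun σ : Equiv.Perm (Fin n) => x₀ ∘ σ = x).eq_empty_or_nonempty
          with h | ⟨τ, hτ⟩
        · rw [h, sum_empty]
          exact mul_nonneg hC (prod_nonneg fun l _ => mul_nonneg (empDist_nonneg _ _) (hg _ _))
        · have hτ' := (mem_filter.1 hτ).2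
          have hdist : ∏ l, empDist x₀ (x l)
              = ∏ a, empDist x₀ a ^ (univ.filter fun i => x₀ i = a).card := by
            rw [← hpd τ, ← hτ']; rfl
          calc ∑ σ ∈ univ.filter (fun σ : Equiv.Perm (Fin n) => x₀ ∘ σ = x),
                ∏ l, g l (x₀ (σ l))
              = ∑ σ ∈ univ.filter (fun σ : Equiv.Perm (Fin n) => x₀ ∘ σ = x), ∏ l, g l (x l) :=
                sum_congr rfl fun σ hσ => by rw [← (mem_filter.1 hσ).2]; rfl
            _ = (univ.filter fun σ : Equiv.Perm (Fin n) => x₀ ∘ σ = x).card * ∏ l, g l (x l) := by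
                rw [sum_const, nsmul_eq_mul]
            _ ≤ F * ∏ l, g l (x l) := by
                gcongr
                have := card_perm_comp_eq_le x₀ x
                rw [hF]
                exact_mod_cast this
            _ ≤ (n.factorial * (Real.exp 1 * n) ^ Fintype.card X *
                  ∏ a, empDist x₀ a ^ (univ.filter fun i => x₀ i = a).card) *
                  ∏ l, g l (x l) := by
                gcongr
                exact prod_factorial_le hn x₀
            _ = _ := by rw [← hdist, prod_mul_distrib, mul_assoc]
    _ = _ := by
        rw [← mul_sum, prod_univ_sum, Fintype.piFinset_univ]

lemma empDist_comp_perm {n : ℕ} {X : Type*} (x : Fin n → X) (σ : Equiv.Perm (Fin n)) :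
    empDist (x ∘ σ) = empDist x := by
  classical
  funext a
  unfold empDist
  congr 2
  refine card_bij (fun i _ => σ i) ?_ ?_ ?_
  · intro i hi; simpa using hi
  · intro i _ j _ h; exact σ.injective h
  · intro j hj; exact ⟨σ.symm j, by simpa using hj, by simp⟩

end Permutations

section RandomRearrangement

variable {X Y : Type*} [Fintype Y]

/-- Bhattacharyya coefficient of the product channel. -/
def bhattN (W : X → Y → ℝ) {n : ℕ} (x x' : Fin n → X) : ℝ := ∏ l, bhatt W (x l) (x' l)

lemma bhattN_nonneg (W : X → Y → ℝ) {n : ℕ} (x x' : Fin n → X) : 0 ≤ bhattN W x x' :=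
  Finset.prod_nonneg fun _ _ => bhatt_nonneg _ _ _

lemma bhattN_comm (W : X → Y → ℝ) {n : ℕ} (x x' : Fin n → X) : bhattN W x x' = bhattN W x' x :=
  Finset.prod_congr rfl fun _ _ => bhatt_comm _ _ _

lemma bhattN_comp_perm (W : X → Y → ℝ) {n : ℕ} (x x' : Fin n → X) (σ : Equiv.Perm (Fin n)) :
    bhattN W (x ∘ σ) (x' ∘ σ) = bhattN W x x' :=
  Equiv.prod_comp σ fun l => bhatt W (x l) (x' l)

lemma sum_sqrt_Wn_mul_Wn {W : X → Y → ℝ} (hW : ∀ x, W x ∈ stdSimplex ℝ Y) {n : ℕ}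
    (x x' : Fin n → X) : ∑ y, Real.sqrt (Wn W x y * Wn W x' y) = bhattN W x x' := by
  classical
  unfold bhattN bhatt
  rw [Finset.prod_univ_sum, Fintype.piFinset_univ]
  refine Finset.sum_congr rfl fun y _ => ?_
  unfold Wn
  rw [← Finset.prod_mul_distrib, Real.sqrt_prod]
  exact fun l _ => mul_nonneg ((hW _).1 _) ((hW _).1 _)

variable [Fintype X]

/-- Averaging over rearrangements of `x'`, with the composition of `x` controlling the exponent. -/
lemma sum_perm_bhattN_right_le {W : X → Y → ℝ} (hW : ∀ x, W x ∈ stdSimplex ℝ Y) {Q : X → ℝ}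
    (hQ : Q ∈ stdSimplex ℝ X) {ρ ε : ℝ} (hρ : 0 < ρ) (hε1 : ε < 1) {n : ℕ} (hn : 0 < n)
    (x x' : Fin n → X) (hx : ∀ a, (1 - ε) * Q a ≤ empDist x a) :
    ∑ σ : Equiv.Perm (Fin n), bhattN W x (x' ∘ σ) ^ (1 / ρ) ≤
      n.factorial * ((Real.exp 1 * n) ^ Fintype.card X *
        Real.exp (-(n * ((1 - ε) * exReal W Q ρ) / ρ))) := by
  have h := sum_perm_prod_le hn x' (fun l a => bhatt W (x l) a ^ (1 / ρ))
    (fun l a => Real.rpow_nonneg (bhatt_nonneg _ _ _) _)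
  have h2 := prod_tiltedBhatt_le hW hQ (empDist_mem_stdSimplex hn x') hρ hε1 hn x hx
  calc ∑ σ : Equiv.Perm (Fin n), bhattN W x (x' ∘ σ) ^ (1 / ρ)
      = ∑ σ : Equiv.Perm (Fin n), ∏ l, bhatt W (x l) (x' (σ l)) ^ (1 / ρ) := by
        refine Finset.sum_congr rfl fun σ _ => ?_
        unfold bhattN
        rw [← Real.finsetProd_rpow _ _ fun l _ => bhatt_nonneg _ _ _]
        rfl
    _ ≤ _ := h
    _ ≤ n.factorial * (Real.exp 1 * n) ^ Fintype.card X *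
        Real.exp (-(n * ((1 - ε) * exReal W Q ρ) / ρ)) := by
        gcongr
        exact h2
    _ = _ := by ring

lemma sum_perm_bhattN_le {W : X → Y → ℝ} (hW : ∀ x, W x ∈ stdSimplex ℝ Y) {Q : X → ℝ}
    (hQ : Q ∈ stdSimplex ℝ X) {ρ ε : ℝ} (hρ : 0 < ρ) (hε1 : ε < 1) {n : ℕ} (hn : 0 < n)
    (x x' : Fin n → X) (τ : Equiv.Perm (Fin n))
    (hx : (∀ a, (1 - ε) * Q a ≤ empDist x a) ∨ (∀ a, (1 - ε) * Q a ≤ empDist x' a)) :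
    ∑ σ : Equiv.Perm (Fin n), bhattN W (x ∘ σ) (x' ∘ τ) ^ (1 / ρ) ≤
      n.factorial * ((Real.exp 1 * n) ^ Fintype.card X *
        Real.exp (-(n * ((1 - ε) * exReal W Q ρ) / ρ))) := by
  rcases hx with hx | hx
  · refine le_trans (le_of_eq ?_) (sum_perm_bhattN_right_le hW hQ hρ hε1 hn x x' hx)
    refine Fintype.sum_equiv ((Equiv.inv (Equiv.Perm (Fin n))).trans (Equiv.mulLeft τ)) _ _
      fun σ => ?_
    rw [← bhattN_comp_perm W x _ σ]
    congr 2
    funext l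
    simp
  · refine le_trans (le_of_eq ?_) (sum_perm_bhattN_right_le hW hQ hρ hε1 hn (x' ∘ τ) x ?_)
    · exact Finset.sum_congr rfl fun σ _ => by rw [bhattN_comm]
    · rwa [empDist_comp_perm]

end RandomRearrangement

section Greedy

open Finset

/-- Greedy selection: if the average cost of a new element against any earlier choice is bounded,
elements can be chosen one after the other with total cost against their predecessors bounded. -/
lemma exists_greedy_choice {α G ι : Type*} [Fintype α] [Fintype G] [Nonempty G] [LinearOrder ι]
    (r : α → ι) (c : α → α → G → G → ℝ) (w : α → α → ℝ)
    (h : ∀ v u τ, ∑ σ, c v u σ τ ≤ Fintype.card G * w v u) :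
    ∃ s : α → G, ∀ v, ∑ u ∈ univ.filter (fun u => r u < r v), c v u (s v) (s u)
      ≤ ∑ u ∈ univ.filter (fun u => r u < r v), w v u := by
  classical
  suffices H : ∀ S : Finset α, ∃ s : α → G, ∀ v ∈ S,
      ∑ u ∈ S.filter (fun u => r u < r v), c v u (s v) (s u)
        ≤ ∑ u ∈ S.filter (fun u => r u < r v), w v u by
    obtain ⟨s, hs⟩ := H univ
    exact ⟨s, fun v => hs v (mem_univ v)⟩
  intro S
  induction S using Finset.induction_on_max_value r with
  | empty => exact ⟨fun _ => Classical.arbitrary G, by simp⟩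
  | insert a S haS hmax ih =>
    obtain ⟨s, hs⟩ := ih
    obtain ⟨σ, -, hσ⟩ : ∃ σ ∈ (univ : Finset G),
        ∑ u ∈ S.filter (fun u => r u < r a), c a u σ (s u)
          ≤ ∑ u ∈ S.filter (fun u => r u < r a), w a u := by
      refine exists_le_of_sum_le univ_nonempty ?_
      rw [sum_comm, sum_const, card_univ, nsmul_eq_mul, mul_sum]
      exact sum_le_sum fun u _ => h a u (s u)
    refine ⟨Function.update s a σ, fun v hv => ?_⟩
    have hfil : (insert a S).filter (fun u => r u < r v) = S.filter (fun u => r u < r v) := by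
      rw [filter_insert, if_neg]
      rcases mem_insert.1 hv with rfl | hv
      · exact lt_irrefl _
      · exact not_lt.2 (hmax v hv)
    rw [hfil]
    have hne : ∀ u ∈ S, u ≠ a := fun u hu hua => haS (hua ▸ hu)
    have hupd : ∑ u ∈ S.filter (fun u => r u < r v),
          c v u (Function.update s a σ v) (Function.update s a σ u)
        = ∑ u ∈ S.filter (fun u => r u < r v), c v u (Function.update s a σ v) (s u) :=
      sum_congr rfl fun u hu => by
        rw [Function.update_of_ne (hne u (mem_filter.1 hu).1)]
    rw [hupd]
    rcases mem_insert.1 hv with rfl | hv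
    · rwa [Function.update_self]
    · rw [Function.update_of_ne (hne v hv)]
      exact hs v hv

end Greedy

section Decoder

open Finset

variable {V X Y : Type*} [Fintype V] [Fintype Y]

lemma prodDist_nonneg {PV : V → ℝ} (hPV : PV ∈ stdSimplex ℝ V) {k : ℕ} (v : Fin k → V) :
    0 ≤ prodDist PV v := prod_nonneg fun _ _ => hPV.1 _

lemma Wn_nonneg {W : X → Y → ℝ} (hW : ∀ x, W x ∈ stdSimplex ℝ Y) {n : ℕ} (x : Fin n → X)
    (y : Fin n → Y) : 0 ≤ Wn W x y := prod_nonneg fun _ _ => (hW _).1 _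

/-- Union bound for the maximum a posteriori decoder in terms of Bhattacharyya coefficients. -/
lemma exists_decoder_pErr_le {ι : Type*} [LinearOrder ι] {PV : V → ℝ} (hPV : PV ∈ stdSimplex ℝ V)
    {W : X → Y → ℝ} (hW : ∀ x, W x ∈ stdSimplex ℝ Y) {k n : ℕ}
    (f : (Fin k → V) → Fin n → X) (r : (Fin k → V) → ι) (hr : Function.Injective r) :
    ∃ φ : (Fin n → Y) → Fin k → V, pErr PV W f φ ≤
      2 * ∑ v, ∑ u ∈ univ.filter (fun u => r u < r v),
        Real.sqrt (prodDist PV v * prodDist PV u) * bhattN W (f v) (f u) := by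
  classical
  have hV : Nonempty V := by
    by_contra h
    rw [not_nonempty_iff] at h
    simpa using hPV.2
  have hp := fun v : Fin k → V => prodDist_nonneg hPV v
  have hw := fun v y => Wn_nonneg hW (f v) y
  have hex : ∀ y : Fin n → Y, ∃ v₀, ∀ v, prodDist PV v * Wn W (f v) y
      ≤ prodDist PV v₀ * Wn W (f v₀) y := fun y =>
    Finite.exists_max fun v => prodDist PV v * Wn W (f v) y
  choose φ hφ using hex
  refine ⟨φ, ?_⟩
  set T : (Fin k → V) → (Fin k → V) → ℝ := fun v u =>
    Real.sqrt (prodDist PV v * prodDist PV u) * bhattN W (f v) (f u) with hT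
  have hTcomm : ∀ v u, T v u = T u v := fun v u => by
    simp only [hT]; rw [bhattN_comm, mul_comm (prodDist PV v)]
  have hTsum : ∀ v u, ∑ y, Real.sqrt ((prodDist PV v * Wn W (f v) y) *
      (prodDist PV u * Wn W (f u) y)) = T v u := by
    intro v u
    simp only [hT]
    rw [← sum_sqrt_Wn_mul_Wn hW, mul_sum]
    refine sum_congr rfl fun y _ => ?_
    rw [← Real.sqrt_mul (mul_nonneg (hp v) (hp u))]
    congr 1
    ring
  have h1 : pErr PV W f φ ≤ ∑ v, ∑ u ∈ univ.filter (fun u => u ≠ v), T v u := by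
    unfold pErr
    refine sum_le_sum fun v _ => ?_
    rw [mul_sum]
    calc ∑ y ∈ univ.filter (fun y => φ y ≠ v), prodDist PV v * Wn W (f v) y
        ≤ ∑ y ∈ univ.filter (fun y => φ y ≠ v), ∑ u ∈ univ.filter (fun u => u ≠ v),
            Real.sqrt ((prodDist PV v * Wn W (f v) y) * (prodDist PV u * Wn W (f u) y)) := by
          refine sum_le_sum fun y hy => ?_
          have hy' := (mem_filter.1 hy).2
          refine le_trans ?_ (single_le_sum (f := fun u => Real.sqrt
            ((prodDist PV v * Wn W (f v) y) * (prodDist PV u * Wn W (f u) y)))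
            (fun u _ => Real.sqrt_nonneg _) (mem_filter.2 ⟨mem_univ (φ y), hy'⟩))
          apply Real.le_sqrt_of_sq_le
          rw [sq]
          exact mul_le_mul_of_nonneg_left (hφ y v) (mul_nonneg (hp v) (hw v y))
      _ ≤ ∑ y, ∑ u ∈ univ.filter (fun u => u ≠ v),
            Real.sqrt ((prodDist PV v * Wn W (f v) y) * (prodDist PV u * Wn W (f u) y)) :=
          sum_le_sum_of_subset_of_nonneg (filter_subset _ _)
            fun y _ _ => sum_nonneg fun u _ => Real.sqrt_nonneg _
      _ = _ := by
          rw [sum_comm]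
          exact sum_congr rfl fun u _ => hTsum v u
  refine h1.trans (le_of_eq ?_)
  have hsplit : ∀ v, ∑ u ∈ univ.filter (fun u => u ≠ v), T v u
      = ∑ u ∈ univ.filter (fun u => r u < r v), T v u
        + ∑ u ∈ univ.filter (fun u => r v < r u), T v u := by
    intro v
    rw [← sum_union]
    · refine sum_congr ?_ fun _ _ => rfl
      ext u
      simp only [mem_filter, mem_univ, true_and, mem_union]
      rw [← lt_or_lt_iff_ne (a := r u) |>.trans hr.ne_iff]
    · rw [disjoint_left]
      intro u hu hu'
      exact lt_asymm (mem_filter.1 hu).2 (mem_filter.1 hu').2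
  simp_rw [hsplit]
  rw [sum_add_distrib, two_mul]
  congr 1
  simp_rw [sum_filter]
  rw [sum_comm]
  refine sum_congr rfl fun v _ => sum_congr rfl fun u _ => ?_
  rw [hTcomm]

end Decoder

section Source

open Finset

variable {V : Type*} [Fintype V]

/-- The number of sequences with the same composition as `v`. -/
def typeSize {k : ℕ} (v : Fin k → V) : ℕ := (typeClass k (empDist v)).card

lemma typeSize_pos {k : ℕ} (v : Fin k → V) : 0 < typeSize v :=
  card_pos.2 ⟨v, by simp [typeClass]⟩

lemma typeSize_le {k : ℕ} (v : Fin k → V) : typeSize v ≤ Fintype.card V ^ k := by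
  unfold typeSize
  refine (card_le_univ _).trans ?_
  simp

lemma prodDist_eq_of_empDist_eq (PV : V → ℝ) {k : ℕ} {u v : Fin k → V}
    (h : empDist u = empDist v) : prodDist PV u = prodDist PV v := by
  classical
  have hprod : ∀ w : Fin k → V,
      prodDist PV w = ∏ a, PV a ^ (univ.filter fun i => w i = a).card := by
    intro w
    unfold prodDist
    rw [← prod_fiberwise_of_maps_to (s := univ) (t := univ) (g := w) (fun _ _ => mem_univ _)]
    refine prod_congr rfl fun a _ => ?_
    rw [← prod_const]
    exact prod_congr rfl fun i hi => by rw [(mem_filter.1 hi).2]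
  rcases Nat.eq_zero_or_pos k with rfl | hk
  · rw [Subsingleton.elim u v]
  · have hk' : (k : ℝ) ≠ 0 := by exact_mod_cast hk.ne'
    rw [hprod, hprod]
    refine prod_congr rfl fun a _ => ?_
    have ha := congrFun h a
    unfold empDist at ha
    rw [div_left_inj' hk', Nat.cast_inj] at ha
    congr 1

lemma one_le_sum_rpow {PV : V → ℝ} (hPV : PV ∈ stdSimplex ℝ V) {s : ℝ} (hs : s ≤ 1)
    (hs0 : 0 < s) : 1 ≤ ∑ v, PV v ^ s := by
  rw [← hPV.2]
  refine sum_le_sum fun v _ => ?_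
  rcases (hPV.1 v).eq_or_lt with h | h
  · rw [← h, Real.zero_rpow hs0.ne']
  · have h1 : PV v ≤ 1 := hPV.2 ▸ single_le_sum (fun u _ => hPV.1 u) (mem_univ v)
    simpa using Real.rpow_le_rpow_of_exponent_ge h h1 hs

lemma Es_nonneg {PV : V → ℝ} (hPV : PV ∈ stdSimplex ℝ V) {lam : ℝ} (hlam : 0 ≤ lam) :
    0 ≤ Es PV lam := by
  unfold Es
  refine mul_nonneg (by linarith) (Real.log_nonneg (one_le_sum_rpow hPV ?_ (by positivity)))
  rw [div_le_one (by linarith)]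
  linarith

/-- A type class of size `M` whose members have probability `p` satisfies
`p M^{1+λ} ≤ e^{k E_s(λ)}`. -/
lemma prodDist_mul_typeSize_rpow_le {PV : V → ℝ} (hPV : PV ∈ stdSimplex ℝ V) {lam : ℝ}
    (hlam : 0 ≤ lam) {k : ℕ} (v : Fin k → V) :
    prodDist PV v * (typeSize v : ℝ) ^ (1 + lam) ≤ Real.exp (k * Es PV lam) := by
  classical
  have h0 : (0 : ℝ) < 1 + lam := by linarith
  set s : ℝ := 1 / (1 + lam) with hs
  have hs0 : 0 < s := by positivity
  have hs1 : s ≤ 1 := by rw [hs, div_le_one h0]; linarith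
  have hS := one_le_sum_rpow hPV hs1 hs0
  have h1 : (typeSize v : ℝ) * prodDist PV v ^ s ≤ (∑ a, PV a ^ s) ^ k := by
    calc (typeSize v : ℝ) * prodDist PV v ^ s
        = ∑ u ∈ typeClass k (empDist v), prodDist PV u ^ s := by
          rw [typeSize, ← nsmul_eq_mul, ← sum_const]
          refine sum_congr rfl fun u hu => ?_
          have : empDist u = empDist v := by simpa [typeClass] using hu
          rw [prodDist_eq_of_empDist_eq PV this]
      _ ≤ ∑ u : Fin k → V, prodDist PV u ^ s :=
          sum_le_sum_of_subset_of_nonneg (subset_univ _)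
            fun u _ _ => Real.rpow_nonneg (prodDist_nonneg hPV u) _
      _ = (∑ a, PV a ^ s) ^ k := by
          have : (∑ a, PV a ^ s) ^ k = ∏ _i : Fin k, ∑ a, PV a ^ s := by simp
          rw [this, prod_univ_sum, Fintype.piFinset_univ]
          refine sum_congr rfl fun u _ => ?_
          unfold prodDist
          rw [← Real.finsetProd_rpow _ _ fun i _ => hPV.1 _]
  have h2 := Real.rpow_le_rpow (mul_nonneg (Nat.cast_nonneg _)
    (Real.rpow_nonneg (prodDist_nonneg hPV v) _)) h1 h0.le
  rw [Real.mul_rpow (Nat.cast_nonneg _) (Real.rpow_nonneg (prodDist_nonneg hPV v) _),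
    ← Real.rpow_mul (prodDist_nonneg hPV v), hs, one_div_mul_cancel h0.ne', Real.rpow_one,
    mul_comm] at h2
  refine h2.trans (le_of_eq ?_)
  unfold Es
  rw [← hs, Real.rpow_def_of_pos (by positivity), Real.log_pow]
  congr 1
  ring

lemma sum_inv_typeSize_le (k : ℕ) :
    ∑ v : Fin k → V, (1 : ℝ) / typeSize v ≤ ((k : ℝ) + 1) ^ Fintype.card V := by
  classical
  have h1 : ∑ v : Fin k → V, (1 : ℝ) / typeSize v
      = ((univ : Finset (Fin k → V)).image empDist).card := by
    rw [← sum_fiberwise_of_maps_to (s := univ) (t := univ.image empDist) (g := empDist)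
      (fun v _ => mem_image_of_mem _ (mem_univ v)), card_eq_sum_ones, Nat.cast_sum]
    refine sum_congr rfl fun P hP => ?_
    obtain ⟨v, -, rfl⟩ := mem_image.1 hP
    have hfil : (univ.filter fun u : Fin k → V => empDist u = empDist v)
        = typeClass k (empDist v) := by
      unfold typeClass; congr!
    rw [hfil]
    have : ∀ u ∈ typeClass k (empDist v), (1 : ℝ) / typeSize u = 1 / typeSize v := by
      intro u hu
      have : empDist u = empDist v := by simpa [typeClass] using hu
      rw [typeSize, this, typeSize]
    rw [sum_congr rfl this, sum_const, nsmul_eq_mul]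
    have hpos : ((typeSize v : ℕ) : ℝ) ≠ 0 := by exact_mod_cast (typeSize_pos v).ne'
    change (typeSize v : ℝ) * (1 / typeSize v) = _
    field_simp
    simp
  rw [h1]
  have h2 : (univ : Finset (Fin k → V)).image empDist ⊆
      (univ : Finset (V → Fin (k + 1))).image (fun c a => ((c a : ℕ) : ℝ) / k) := by
    intro P hP
    obtain ⟨v, -, rfl⟩ := mem_image.1 hP
    refine mem_image.2 ⟨fun a => ⟨(univ.filter fun i => v i = a).card, ?_⟩, mem_univ _, ?_⟩
    · have := card_le_univ (univ.filter fun i => v i = a)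
      simp only [Fintype.card_fin] at this
      lia
    · funext a
      unfold empDist
      congr!
  have h3 := (card_le_card h2).trans card_image_le
  rw [card_univ, Fintype.card_fun, Fintype.card_fin] at h3
  exact_mod_cast h3

end Source

section CodeConstruction

open Finset

lemma le_mul_rpow_of_scaled_root_le {A ρ ρm s N L M z : ℝ} (hA : 0 ≤ A) (hρ : 1 ≤ ρ)
    (hρm : ρ ≤ ρm) (hN : 1 ≤ N) (hL : 1 ≤ L) (hM : 0 < M)
    (hs : s = A ^ (1 / ρ) * Real.exp (z / ρ) / (L * M)) (hsN : s ≤ N) :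
    A ≤ s * (N * L) ^ ρm * (M ^ ρ * Real.exp (-z)) := by
  have hρ0 : 0 < ρ := by linarith
  have hL0 : 0 < L := by linarith
  have hN0 : 0 < N := by linarith
  have hs0 : 0 ≤ s := by rw [hs]; positivity
  have hroot : A ^ (1 / ρ) = s * L * M * Real.exp (-(z / ρ)) := by
    rw [hs, Real.exp_neg]
    field_simp
  have hAeq : A = s ^ ρ * L ^ ρ * (M ^ ρ * Real.exp (-z)) := by
    have h1 : A = (A ^ (1 / ρ)) ^ ρ := by
      rw [← Real.rpow_mul hA, one_div_mul_cancel hρ0.ne', Real.rpow_one]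
    rw [h1, hroot, Real.mul_rpow (by positivity) (Real.exp_pos _).le,
      Real.mul_rpow (by positivity) hM.le, Real.mul_rpow hs0 hL0.le, ← Real.exp_mul]
    have : -(z / ρ) * ρ = -z := by field_simp
    rw [this]
    ring
  have hsρ : s ^ ρ ≤ s * N ^ ρ := by
    have h1 : s ^ ρ = s * s ^ (ρ - 1) := by
      rw [← Real.rpow_one_add' hs0 (by linarith)]
      congr 1; ring
    rw [h1]
    refine mul_le_mul_of_nonneg_left ?_ hs0
    exact (Real.rpow_le_rpow hs0 hsN (by linarith)).trans
      (Real.rpow_le_rpow_of_exponent_le hN (by linarith))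
  calc A = s ^ ρ * L ^ ρ * (M ^ ρ * Real.exp (-z)) := hAeq
    _ ≤ s * N ^ ρ * L ^ ρ * (M ^ ρ * Real.exp (-z)) := by gcongr
    _ = s * (N * L) ^ ρ * (M ^ ρ * Real.exp (-z)) := by rw [Real.mul_rpow hN0.le hL0.le]; ring
    _ ≤ _ := by
      gcongr
      nlinarith

variable {V X Y : Type*} [Fintype V] [Fintype X] [Fintype Y]

/-- Existence of a code whose codewords rearrange prescribed reference sequences `x₀ v`, with the
weak expurgated exponent simultaneously for all source type classes. -/
lemma exists_code_pErr_le {PV : V → ℝ} (hPV : PV ∈ stdSimplex ℝ V)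
    {W : X → Y → ℝ} (hW : ∀ x, W x ∈ stdSimplex ℝ Y) {k n : ℕ} (hn : 0 < n)
    {ε : ℝ} (hε1 : ε < 1) (x₀ : (Fin k → V) → Fin n → X) (Q : (Fin k → V) → X → ℝ)
    (hQ : ∀ v, Q v ∈ stdSimplex ℝ X) (hx₀ : ∀ v a, (1 - ε) * Q v a ≤ empDist (x₀ v) a)
    {ρm : ℝ} (ρ : (Fin k → V) → ℝ) (hρ1 : ∀ v, 1 ≤ ρ v) (hρm : ∀ v, ρ v ≤ ρm)
    {Γ : ℝ} (hΓ0 : 0 ≤ Γ)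
    (hΓ : ∀ v, prodDist PV v * typeSize v * ((typeSize v : ℝ) ^ ρ v *
      Real.exp (-(n * ((1 - ε) * exReal W (Q v) (ρ v))))) ≤ Γ) :
    ∃ (f : (Fin k → V) → Fin n → X) (φ : (Fin n → Y) → Fin k → V),
      (∀ v, empDist (f v) = empDist (x₀ v)) ∧
      pErr PV W f φ ≤ 2 * ((2 * ((k : ℝ) + 1) ^ Fintype.card V *
        (Real.exp 1 * n) ^ Fintype.card X) ^ ρm * (((k : ℝ) + 1) ^ Fintype.card V) ^ 2 * Γ) := by
  classical
  set N : ℝ := ((k : ℝ) + 1) ^ Fintype.card V with hN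
  set L : ℝ := (Real.exp 1 * n) ^ Fintype.card X with hL
  set z : (Fin k → V) → ℝ := fun v => n * ((1 - ε) * exReal W (Q v) (ρ v)) with hz
  set M : (Fin k → V) → ℝ := fun v => typeSize v with hM
  set K : ℝ := (2 * N * L) ^ ρm with hK
  have hN1 : 1 ≤ N := one_le_pow₀ (by linarith [Nat.cast_nonneg (α := ℝ) k])
  have hL1 : 1 ≤ L := by
    refine one_le_pow₀ (one_le_mul_of_one_le_of_one_le ?_ (by exact_mod_cast hn))
    exact Real.one_le_exp (by norm_num)
  have hL0 : 0 < L := by linarith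
  have hK0 : 0 ≤ K := by positivity
  have hM0 : ∀ v, 0 < M v := fun v => by
    simp only [hM]; exact_mod_cast typeSize_pos v
  have hρ0 : ∀ v, 0 < ρ v := fun v => by linarith [hρ1 v]
  let r : (Fin k → V) → ℕ ×ₗ Fin (Fintype.card (Fin k → V)) :=
    fun v => toLex (typeSize v, Fintype.equivFin _ v)
  have hr : Function.Injective r := by
    intro u v h
    have h1 := congrArg (fun p => (ofLex p).2) h
    exact (Fintype.equivFin _).injective h1
  have hrM : ∀ u v, r u < r v → M u ≤ M v := by
    intro u v h
    simp only [hM]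
    rcases Prod.Lex.lt_iff.1 h with h | h
    · exact_mod_cast h.le
    · exact_mod_cast h.1.le
  let term : (Fin k → V) → (Fin k → V) → (Fin k → V) → Equiv.Perm (Fin n) →
      Equiv.Perm (Fin n) → ℝ := fun i v u σ τ =>
    bhattN W (x₀ v ∘ σ) (x₀ u ∘ τ) ^ (1 / ρ i) * Real.exp (z i / ρ i) / (L * M u)
  have hterm0 : ∀ i v u σ τ, 0 ≤ term i v u σ τ := fun i v u σ τ =>
    div_nonneg (mul_nonneg (Real.rpow_nonneg (bhattN_nonneg _ _ _) _) (Real.exp_pos _).le)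
      (mul_pos hL0 (hM0 u)).le
  have hterm : ∀ i v u τ, (i = v ∨ i = u) →
      ∑ σ, term i v u σ τ ≤ Fintype.card (Equiv.Perm (Fin n)) * (1 / M u) := by
    intro i v u τ hi
    have h1 := sum_perm_bhattN_le hW (hQ i) (hρ0 i) hε1 hn (x₀ v) (x₀ u) τ (by
      rcases hi with rfl | rfl
      · exact Or.inl (hx₀ i)
      · exact Or.inr (hx₀ i))
    have hMu := hM0 u
    simp only [term]
    rw [← sum_div, ← sum_mul, div_le_iff₀ (mul_pos hL0 hMu), Fintype.card_perm, Fintype.card_fin]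
    calc _ ≤ (n.factorial * (L * Real.exp (-(z i / ρ i)))) * Real.exp (z i / ρ i) := by
          gcongr
      _ = _ := by
          rw [Real.exp_neg]
          field_simp
  obtain ⟨s, hs⟩ := exists_greedy_choice r (fun v u σ τ => term u v u σ τ + term v v u σ τ)
    (fun v u => 2 * (1 / M u)) (by
      intro v u τ
      rw [sum_add_distrib]
      have h1 := hterm u v u τ (Or.inr rfl)
      have h2 := hterm v v u τ (Or.inl rfl)
      linarith)
  let f : (Fin k → V) → Fin n → X := fun v => x₀ v ∘ s v
  obtain ⟨φ, hφ⟩ := exists_decoder_pErr_le hPV hW f r hr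
  refine ⟨f, φ, fun v => empDist_comp_perm _ _, hφ.trans ?_⟩
  have hcost : ∀ v, ∑ u ∈ univ.filter (fun u => r u < r v),
      (term u v u (s v) (s u) + term v v u (s v) (s u)) ≤ 2 * N := by
    intro v
    refine (hs v).trans ?_
    rw [← mul_sum]
    refine mul_le_mul_of_nonneg_left ?_ zero_le_two
    refine le_trans (sum_le_sum_of_subset_of_nonneg (filter_subset _ _)
      fun u _ _ => (one_div_pos.2 (hM0 u)).le) ?_
    exact sum_inv_typeSize_le k
  have hpair : ∀ v u, r u < r v →
      Real.sqrt (prodDist PV v * prodDist PV u) * bhattN W (f v) (f u)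
        ≤ K * Γ / 2 * (1 / M v) * (term u v u (s v) (s u) + term v v u (s v) (s u)) := by
    intro v u huv
    set A := bhattN W (f v) (f u) with hA
    set s₁ := term u v u (s v) (s u) with hs₁
    set s₂ := term v v u (s v) (s u) with hs₂
    have hs₁0 : 0 ≤ s₁ := hterm0 _ _ _ _ _
    have hs₂0 : 0 ≤ s₂ := hterm0 _ _ _ _ _
    have hA0 : 0 ≤ A := bhattN_nonneg _ _ _
    have hsum : s₁ + s₂ ≤ 2 * N := by
      refine le_trans ?_ (hcost v)
      exact single_le_sum (f := fun u => term u v u (s v) (s u) + term v v u (s v) (s u))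
        (fun u _ => add_nonneg (hterm0 _ _ _ _ _) (hterm0 _ _ _ _ _))
        (mem_filter.2 ⟨mem_univ u, huv⟩)
    have hMv := hM0 v
    have hMu := hM0 u
    have hMuv := hrM u v huv
    have hA1 : A ≤ s₁ * K * (M u ^ ρ u * Real.exp (-z u)) :=
      le_mul_rpow_of_scaled_root_le hA0 (hρ1 u) (hρm u) (by linarith) hL1 hMu rfl (by linarith)
    have hA2 : A ≤ s₂ * K * (M u ^ ρ v * Real.exp (-z v)) :=
      le_mul_rpow_of_scaled_root_le hA0 (hρ1 v) (hρm v) (by linarith) hL1 hMu rfl (by linarith)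
    have hratio : M u ^ ρ v ≤ M v ^ ρ v * (M u / M v) := by
      have h1 : (M u / M v) ^ ρ v ≤ M u / M v := by
        have := Real.rpow_le_rpow_of_exponent_ge (div_pos hMu hMv)
          ((div_le_one hMv).2 hMuv) (hρ1 v)
        simpa using this
      rw [Real.div_rpow hMu.le hMv.le, div_le_iff₀ (Real.rpow_pos_of_pos hMv _)] at h1
      linarith
    have hA3 : A ≤ s₂ * K * (M v ^ ρ v * (M u / M v) * Real.exp (-z v)) := by
      refine hA2.trans ?_
      gcongr
    have hpv := prodDist_nonneg hPV v
    have hpu := prodDist_nonneg hPV u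
    have hGv := hΓ v
    have hGu := hΓ u
    have hB : ∀ w, 0 ≤ prodDist PV w * M w * (M w ^ ρ w * Real.exp (-z w)) := fun w =>
      mul_nonneg (mul_nonneg (prodDist_nonneg hPV w) (hM0 w).le)
        (mul_nonneg (Real.rpow_nonneg (hM0 w).le _) (Real.exp_pos _).le)
    have hRHS : 0 ≤ K * Γ / 2 * (1 / M v) * (s₁ + s₂) := by positivity
    rw [← pow_le_pow_iff_left₀ (mul_nonneg (Real.sqrt_nonneg _) hA0) hRHS two_ne_zero, mul_pow,
      Real.sq_sqrt (mul_nonneg hpv hpu)]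
    calc prodDist PV v * prodDist PV u * A ^ 2
        ≤ prodDist PV v * prodDist PV u * ((s₁ * K * (M u ^ ρ u * Real.exp (-z u))) *
            (s₂ * K * (M v ^ ρ v * (M u / M v) * Real.exp (-z v)))) := by
          rw [sq]
          gcongr
      _ = K ^ 2 * (1 / M v) ^ 2 * (s₁ * s₂) *
            ((prodDist PV u * M u * (M u ^ ρ u * Real.exp (-z u))) *
             (prodDist PV v * M v * (M v ^ ρ v * Real.exp (-z v)))) := by
          field_simp
      _ ≤ K ^ 2 * (1 / M v) ^ 2 * (((s₁ + s₂) / 2) ^ 2) * (Γ * Γ) := by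
          have h4 : s₁ * s₂ ≤ ((s₁ + s₂) / 2) ^ 2 := by nlinarith [sq_nonneg (s₁ - s₂)]
          refine mul_le_mul ?_ (mul_le_mul hGu hGv (hB v) hΓ0) (mul_nonneg (hB u) (hB v))
            (by positivity)
          gcongr
      _ = _ := by ring
  have hmain : ∑ v, ∑ u ∈ univ.filter (fun u => r u < r v),
      Real.sqrt (prodDist PV v * prodDist PV u) * bhattN W (f v) (f u) ≤ K * N ^ 2 * Γ := by
    calc _ ≤ ∑ v, K * Γ / 2 * (1 / M v) * (2 * N) := by
          refine sum_le_sum fun v _ => ?_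
          refine (sum_le_sum fun u hu => hpair v u (mem_filter.1 hu).2).trans ?_
          rw [← mul_sum]
          refine mul_le_mul_of_nonneg_left (hcost v) ?_
          have := hM0 v
          positivity
      _ = K * Γ * N * ∑ v, 1 / M v := by
          rw [mul_sum]
          exact sum_congr rfl fun v _ => by ring
      _ ≤ K * Γ * N * N := by
          refine mul_le_mul_of_nonneg_left (sum_inv_typeSize_le k) (by positivity)
      _ = _ := by ring
  linarith

end CodeConstruction

open Filter Topology in
/-- Every distribution is approximated by types that nearly dominate it. -/
lemma eventually_exists_empDist_approx {X : Type*} [Fintype X] {Q : X → ℝ}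
    (hQ : Q ∈ stdSimplex ℝ X) {δ ε : ℝ} (hδ : 0 < δ) (hε : 0 < ε) :
    ∀ᶠ n : ℕ in atTop, ∃ x : Fin n → X, (∀ a, |empDist x a - Q a| ≤ δ) ∧
      ∀ a, (1 - ε) * Q a ≤ empDist x a := by
  classical
  have hne : Nonempty X := by
    by_contra h
    rw [not_nonempty_iff] at h
    simpa using hQ.2
  have hlim : Tendsto (fun n : ℕ => (1 : ℝ) / n) atTop (𝓝 0) := tendsto_one_div_atTop_nhds_zero_nat
  have hc : (0 : ℝ) < Fintype.card X := by exact_mod_cast Fintype.card_pos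
  have h1 : ∀ᶠ n : ℕ in atTop, (1 : ℝ) / n < δ / Fintype.card X :=
    hlim.eventually (gt_mem_nhds (by positivity))
  have h2 : ∀ᶠ n : ℕ in atTop, ∀ a, Q a ≠ 0 → (1 : ℝ) / n < ε * Q a := by
    rw [eventually_all]
    intro a
    by_cases ha : Q a = 0
    · simp [ha]
    · have : 0 < Q a := lt_of_le_of_ne (hQ.1 a) (Ne.symm ha)
      filter_upwards [hlim.eventually (gt_mem_nhds (mul_pos hε this))] with n hn _ using hn
  filter_upwards [h1, h2, eventually_gt_atTop 0] with n hn1 hn2 hn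
  have hn' : (0 : ℝ) < n := by exact_mod_cast hn
  let c : X → ℕ := fun a => ⌊n * Q a⌋₊
  have hcle : ∀ a, (c a : ℝ) ≤ n * Q a := fun a =>
    Nat.floor_le (mul_nonneg hn'.le (hQ.1 a))
  have hcsum : ∑ a, c a ≤ n := by
    have : (∑ a, (c a : ℝ)) ≤ n := by
      calc (∑ a, (c a : ℝ)) ≤ ∑ a, n * Q a := Finset.sum_le_sum fun a _ => hcle a
        _ = n := by rw [← Finset.mul_sum, hQ.2, mul_one]
    exact_mod_cast this
  obtain ⟨g⟩ : Nonempty ((Σ a, Fin (c a)) ↪ Fin n) := by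
    rw [Function.Embedding.nonempty_iff_card_le]
    simpa using hcsum
  let x : Fin n → X := Function.extend g Sigma.fst fun _ => Classical.arbitrary X
  have hx : ∀ s, x (g s) = s.1 := fun s => g.injective.extend_apply _ _ _
  have hcount : ∀ a, c a ≤ (Finset.univ.filter fun i => x i = a).card := by
    intro a
    have := Finset.card_le_card_of_injOn (s := (Finset.univ : Finset (Fin (c a))))
      (t := Finset.univ.filter fun i => x i = a) (fun i => g ⟨a, i⟩)
      (fun i _ => by simp [hx]) (fun i _ j _ h => by simpa using g.injective h)
    simpa using this
  have hlow : ∀ a, Q a - 1 / n ≤ empDist x a := by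
    intro a
    have h3 : n * Q a - 1 ≤ c a := (Nat.sub_one_lt_floor _).le
    have h4 : (c a : ℝ) ≤ (Finset.univ.filter fun i => x i = a).card := by
      exact_mod_cast hcount a
    have h5 : empDist x a = ((Finset.univ.filter fun i => x i = a).card : ℝ) / n := by
      unfold empDist; congr!
    rw [h5, le_div_iff₀ hn']
    have : (Q a - 1 / n) * n = n * Q a - 1 := by field_simp
    linarith
  refine ⟨x, fun a => ?_, fun a => ?_⟩
  · have hsum := (empDist_mem_stdSimplex hn x).2
    rw [lt_div_iff₀ hc] at hn1
    have hcard1 : (1 : ℝ) ≤ Fintype.card X := by exact_mod_cast Fintype.card_pos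
    have hinv : (0 : ℝ) ≤ 1 / n := by positivity
    rw [abs_le]
    constructor
    · have := hlow a
      nlinarith
    · have h6 : ∑ b ∈ Finset.univ.erase a, (Q b - 1 / n) ≤ ∑ b ∈ Finset.univ.erase a, empDist x b :=
        Finset.sum_le_sum fun b _ => hlow b
      rw [Finset.sum_sub_distrib, Finset.sum_const, nsmul_eq_mul] at h6
      have h7 := Finset.add_sum_erase Finset.univ Q (Finset.mem_univ a)
      have h8 := Finset.add_sum_erase Finset.univ (empDist x) (Finset.mem_univ a)
      rw [hQ.2] at h7
      rw [hsum] at h8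
      have h9 : ((Finset.univ.erase a).card : ℝ) ≤ Fintype.card X := by
        exact_mod_cast Finset.card_le_univ _
      have h10 := mul_le_mul_of_nonneg_right h9 hinv
      linarith
  · by_cases ha : Q a = 0
    · rw [ha, mul_zero]; exact empDist_nonneg x a
    · have := hn2 a ha
      have := hlow a
      linarith

/-- Along a bounded range of rates the parameter `ρ` may be taken bounded, at a small loss. -/
lemma exists_bound_of_forall_exists (e : ℝ → ℝ) {lam m η C : ℝ} (hlam : 0 < lam) (hη : 0 < η)
    (S : Set ℝ) (hS : ∀ R ∈ S, ∀ R', R ≤ R' → R' ≤ C → R' ∈ S)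
    (h : ∀ R ∈ S, R ≤ C → ∃ ρ, 1 ≤ ρ ∧ m < e ρ + (lam - ρ) * R) :
    ∃ ρm, ∀ R ∈ S, 0 ≤ R → R ≤ C → ∃ ρ, 1 ≤ ρ ∧ ρ ≤ ρm ∧ m - η < e ρ + (lam - ρ) * R := by
  set d := η / lam with hd
  have hd0 : 0 < d := by positivity
  have hstep : ∀ j : ℕ, ∃ ρm, ∀ R ∈ S, C - j * d < R → R ≤ C →
      ∃ ρ, 1 ≤ ρ ∧ ρ ≤ ρm ∧ m - η < e ρ + (lam - ρ) * R := by
    intro j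
    induction j with
    | zero => exact ⟨0, fun R _ h1 h2 => absurd h2 (by simpa using h1)⟩
    | succ j ih =>
      obtain ⟨ρm, hρm⟩ := ih
      by_cases hmem : C - j * d ∈ S
      · obtain ⟨ρ', hρ1, hρ'⟩ := h _ hmem (by
          have : 0 ≤ j * d := by positivity
          linarith)
        refine ⟨max ρm ρ', fun R hR h1 h2 => ?_⟩
        by_cases h3 : C - j * d < R
        · obtain ⟨ρ, ha, hb, hc⟩ := hρm R hR h3 h2
          exact ⟨ρ, ha, hb.trans (le_max_left _ _), hc⟩
        · refine ⟨ρ', hρ1, le_max_right _ _, ?_⟩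
          push Not at h3
          push_cast at h1
          have h4 : lam * (C - j * d - R) ≤ η := by
            have : lam * d = η := by rw [hd]; field_simp
            nlinarith
          have h5 : 0 ≤ ρ' * (C - j * d - R) := mul_nonneg (by linarith) (by linarith)
          nlinarith
      · refine ⟨ρm, fun R hR h1 h2 => hρm R hR ?_ h2⟩
        by_contra h3
        exact hmem (hS R hR _ (not_lt.1 h3) (by
          have : 0 ≤ j * d := by positivity
          linarith))
  obtain ⟨j, hj⟩ := exists_nat_gt (C / d)
  obtain ⟨ρm, hρm⟩ := hstep j
  refine ⟨ρm, fun R hR h0 h1 => hρm R hR ?_ h1⟩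
  rw [div_lt_iff₀ hd0] at hj
  linarith

open Filter Asymptotics in
lemma eventually_poly_le_exp {t η : ℝ} (ht : 0 < t) (hη : 0 < η) {ρm : ℝ} (hρm : 0 ≤ ρm)
    (a b : ℕ) :
    ∀ᶠ n : ℕ in atTop, 2 * ((2 * (t * n + 1) ^ a * (Real.exp 1 * n) ^ b) ^ ρm *
      ((t * n + 1) ^ a) ^ 2) ≤ Real.exp (η * n) := by
  set C : ℝ := 2 * ((2 * (t + 1) ^ a * Real.exp 1 ^ b) ^ ρm * ((t + 1) ^ a) ^ 2) with hC
  have hC0 : 0 < C := by positivity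
  set p : ℝ := ((a + b : ℕ) : ℝ) * ρm + ((a * 2 : ℕ) : ℝ) with hp
  have h := (isLittleO_rpow_exp_pos_mul_atTop p hη).bound (c := 1 / C) (by positivity)
  have h' := tendsto_natCast_atTop_atTop (R := ℝ) |>.eventually h
  filter_upwards [h', eventually_gt_atTop 0] with n hn hn0
  have hn1 : (1 : ℝ) ≤ n := by exact_mod_cast hn0
  have hn' : (0 : ℝ) < n := by linarith
  rw [Real.norm_of_nonneg (by positivity), Real.norm_of_nonneg (Real.exp_pos _).le,
    div_mul_eq_mul_div, one_mul, le_div_iff₀ hC0] at hn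
  refine le_trans ?_ hn
  have hk : t * n + 1 ≤ (t + 1) * n := by nlinarith
  have hk0 : 0 ≤ t * n + 1 := by positivity
  calc 2 * ((2 * (t * n + 1) ^ a * (Real.exp 1 * n) ^ b) ^ ρm * ((t * n + 1) ^ a) ^ 2)
      ≤ 2 * ((2 * ((t + 1) * n) ^ a * (Real.exp 1 * n) ^ b) ^ ρm * (((t + 1) * n) ^ a) ^ 2) := by
        gcongr
    _ = 2 * (((2 * (t + 1) ^ a * Real.exp 1 ^ b) * (n : ℝ) ^ (a + b)) ^ ρm *
          (((t + 1) ^ a) ^ 2 * (n : ℝ) ^ (a * 2))) := by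
        congr 3
        · rw [mul_pow, mul_pow, pow_add]; ring
        · rw [mul_pow, mul_pow, pow_mul]
    _ = (n : ℝ) ^ p * C := by
        rw [Real.mul_rpow (by positivity) (by positivity), hp, Real.rpow_add hn',
          Real.rpow_mul hn'.le, Real.rpow_natCast, Real.rpow_natCast, hC]
        ring

section Core

variable {V X Y : Type*} [Fintype V] [Fintype X] [Fintype Y]

open Filter in
/-- Achievability: if for every rate one finds a parameter `ρ` for which the distribution in charge
of that rate has a large enough weak expurgated exponent, the two-class partition attains `E`. -/
theorem twoClassAttains_of_forall_exists {PV : V → ℝ} (hPV : PV ∈ stdSimplex ℝ V)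
    {W : X → Y → ℝ} (hW : ∀ x, W x ∈ stdSimplex ℝ Y) {t : ℝ} (ht : 0 < t) {Qa Qb : X → ℝ}
    (hQa : Qa ∈ stdSimplex ℝ X) (hQb : Qb ∈ stdSimplex ℝ X) {R₀ E lam m : ℝ}
    (hlam : 0 < lam) (hE : E < m - t * Es PV lam)
    (ha : ∀ R, 0 ≤ R → R ≤ R₀ → ∃ ρ, 1 ≤ ρ ∧ m < exReal W Qa ρ + (lam - ρ) * R)
    (hb : ∀ R, R₀ < R → R ≤ t * Real.log (Fintype.card V) →
      ∃ ρ, 1 ≤ ρ ∧ m < exReal W Qb ρ + (lam - ρ) * R) :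
    TwoClassAttains PV W t Qa Qb R₀ E := by
  classical
  have hVne : Nonempty V := by
    by_contra h
    rw [not_nonempty_iff] at h
    simpa using hPV.2
  have hXne : Nonempty X := by
    by_contra h
    rw [not_nonempty_iff] at h
    simpa using hQa.2
  set η : ℝ := (m - t * Es PV lam - E) / 3 with hη
  have hη0 : 0 < η := by rw [hη]; linarith
  obtain ⟨ρa, hρa⟩ := exists_bound_of_forall_exists (exReal W Qa) hlam hη0 (Set.Ici 0)
    (fun R hR R' h _ => le_trans (Set.mem_Ici.1 hR) h) (fun R hR hC => ha R hR hC)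
  obtain ⟨ρb, hρb⟩ := exists_bound_of_forall_exists (exReal W Qb) hlam hη0 (Set.Ioi R₀)
    (fun R hR R' h _ => lt_of_lt_of_le (Set.mem_Ioi.1 hR) h) (fun R hR hC => hb R hR hC)
  set ρm : ℝ := max 1 (max ρa ρb) with hρm
  have hρm1 : 1 ≤ ρm := le_max_left _ _
  have hlogX : 0 ≤ Real.log (Fintype.card X) :=
    Real.log_nonneg (by exact_mod_cast Fintype.card_pos)
  set ε : ℝ := min (1 / 2) (η / (ρm * Real.log (Fintype.card X) + 1)) with hε
  have hden : 0 < ρm * Real.log (Fintype.card X) + 1 := by positivity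
  have hε0 : 0 < ε := lt_min (by norm_num) (by positivity)
  have hε1 : ε < 1 := lt_of_le_of_lt (min_le_left _ _) (by norm_num)
  have hεη : ε * (ρm * Real.log (Fintype.card X)) ≤ η := by
    have h1 : ε ≤ η / (ρm * Real.log (Fintype.card X) + 1) := min_le_right _ _
    rw [le_div_iff₀ hden] at h1
    linarith
  have hex : ∀ Q : X → ℝ, Q ∈ stdSimplex ℝ X → ∀ ρ, 1 ≤ ρ → ρ ≤ ρm →
      ε * exReal W Q ρ ≤ η := by
    intro Q hQ ρ h1 h2
    have h3 := exReal_le_mul_log_card hW hQ (ρ := ρ) (by linarith)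
    have h4 : ρ * Real.log (Fintype.card X) ≤ ρm * Real.log (Fintype.card X) := by gcongr
    exact (mul_le_mul_of_nonneg_left (h3.trans h4) hε0.le).trans hεη
  intro δ hδ
  rw [← eventually_atTop]
  filter_upwards [eventually_exists_empDist_approx hQa hδ hε0,
    eventually_exists_empDist_approx hQb hδ hε0,
    eventually_poly_le_exp ht hη0 (zero_le_one.trans hρm1) (Fintype.card V) (Fintype.card X),
    eventually_gt_atTop 0] with n hna hnb hpoly hn
  obtain ⟨xa, hxa1, hxa2⟩ := hna
  obtain ⟨xb, hxb1, hxb2⟩ := hnb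
  have hn' : (0 : ℝ) < n := by exact_mod_cast hn
  set k : ℕ := ⌊t * (n : ℝ)⌋₊ with hk
  have hkt : (k : ℝ) ≤ t * n := Nat.floor_le (by positivity)
  have hMpos : ∀ v : Fin k → V, (1 : ℝ) ≤ typeSize v := fun v => by
    exact_mod_cast typeSize_pos v
  have hR0 : ∀ v : Fin k → V, 0 ≤ Real.log (typeSize v) / n := fun v =>
    div_nonneg (Real.log_nonneg (hMpos v)) hn'.le
  have hRB : ∀ v : Fin k → V,
      Real.log (typeSize v) / n ≤ t * Real.log (Fintype.card V) := by
    intro v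
    have hlogV : 0 ≤ Real.log (Fintype.card V) :=
      Real.log_nonneg (by exact_mod_cast Fintype.card_pos)
    rw [div_le_iff₀ hn']
    calc Real.log (typeSize v) ≤ Real.log ((Fintype.card V : ℝ) ^ k) :=
          Real.log_le_log (by linarith [hMpos v]) (by exact_mod_cast typeSize_le v)
      _ = k * Real.log (Fintype.card V) := Real.log_pow _ _
      _ ≤ t * n * Real.log (Fintype.card V) := by gcongr
      _ = _ := by ring
  have hlow : ∀ v : Fin k → V, v ∈ lowClass V k n R₀ ↔ Real.log (typeSize v) / n ≤ R₀ := by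
    intro v
    rw [div_le_iff₀ hn', Real.log_le_iff_le_exp (by linarith [hMpos v]), mul_comm R₀]
    rfl
  have hpar : ∀ v : Fin k → V, ∃ ρ, 1 ≤ ρ ∧ ρ ≤ ρm ∧
      m - η < exReal W (if v ∈ lowClass V k n R₀ then Qa else Qb) ρ
        + (lam - ρ) * (Real.log (typeSize v) / n) := by
    intro v
    by_cases hv : v ∈ lowClass V k n R₀
    · obtain ⟨ρ, h1, h2, h3⟩ := hρa _ (hR0 v) (hR0 v) ((hlow v).1 hv)
      exact ⟨ρ, h1, h2.trans ((le_max_left _ _).trans (le_max_right _ _)), by rwa [if_pos hv]⟩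
    · obtain ⟨ρ, h1, h2, h3⟩ := hρb _ (Set.mem_Ioi.2 (not_le.1 (mt (hlow v).2 hv))) (hR0 v) (hRB v)
      exact ⟨ρ, h1, h2.trans ((le_max_right _ _).trans (le_max_right _ _)), by rwa [if_neg hv]⟩
  choose ρ hρ1 hρm' hρ using hpar
  have hQ : ∀ v : Fin k → V, (if v ∈ lowClass V k n R₀ then Qa else Qb) ∈ stdSimplex ℝ X := by
    intro v; split_ifs <;> assumption
  obtain ⟨f, φ, hf, herr⟩ := exists_code_pErr_le hPV hW hn hε1
    (fun v : Fin k → V => if v ∈ lowClass V k n R₀ then xa else xb)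
    (fun v => if v ∈ lowClass V k n R₀ then Qa else Qb) hQ
    (fun v a => by
      by_cases hv : v ∈ lowClass V k n R₀
      · simpa only [if_pos hv] using hxa2 a
      · simpa only [if_neg hv] using hxb2 a)
    ρ hρ1 hρm' (Γ := Real.exp (-(n * (E + η)))) (Real.exp_pos _).le (by
      intro v
      set Qv : X → ℝ := if v ∈ lowClass V k n R₀ then Qa else Qb with hQv
      have hM0 : (0 : ℝ) < typeSize v := by linarith [hMpos v]
      set R : ℝ := Real.log (typeSize v) / n with hR
      have hlog : Real.log (typeSize v) = n * R := by rw [hR]; field_simp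
      have hsrc := prodDist_mul_typeSize_rpow_le hPV hlam.le v
      have hsplit : prodDist PV v * typeSize v * ((typeSize v : ℝ) ^ ρ v *
            Real.exp (-(n * ((1 - ε) * exReal W Qv (ρ v)))))
          = (prodDist PV v * (typeSize v : ℝ) ^ (1 + lam)) *
            Real.exp (n * R * (ρ v - lam) - n * ((1 - ε) * exReal W Qv (ρ v))) := by
        have h1 : (typeSize v : ℝ) * (typeSize v : ℝ) ^ ρ v
            = (typeSize v : ℝ) ^ (1 + lam) * Real.exp (n * R * (ρ v - lam)) := by
          rw [← hlog, ← Real.rpow_def_of_pos hM0, ← Real.rpow_add hM0]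
          nth_rewrite 1 [← Real.rpow_one (typeSize v : ℝ)]
          rw [← Real.rpow_add hM0]
          congr 1
          ring
        rw [sub_eq_add_neg (n * R * (ρ v - lam)), Real.exp_add]
        linear_combination (prodDist PV v *
          Real.exp (-(n * ((1 - ε) * exReal W Qv (ρ v))))) * h1
      rw [hsplit]
      refine (mul_le_mul_of_nonneg_right hsrc (Real.exp_pos _).le).trans ?_
      rw [← Real.exp_add]
      apply Real.exp_le_exp.2
      have h2 := hex Qv (hQ v) (ρ v) (hρ1 v) (hρm' v)
      have h3 := hρ v
      have h4 : (k : ℝ) * Es PV lam ≤ t * n * Es PV lam :=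
        mul_le_mul_of_nonneg_right hkt (Es_nonneg hPV hlam.le)
      have h5 : t * Es PV lam + R * (ρ v - lam) - (1 - ε) * exReal W Qv (ρ v) ≤ -(E + η) := by
        have : m - t * Es PV lam - E = 3 * η := by rw [hη]; ring
        nlinarith
      have h6 := mul_le_mul_of_nonneg_left h5 hn'.le
      nlinarith)
  refine ⟨empDist xa, empDist xb, ⟨xa, rfl⟩, ⟨xb, rfl⟩, hxa1, hxb1, f, φ, ?_, ?_, ?_⟩
  · intro v hv
    simp only [typeClass, Finset.mem_filter, Finset.mem_univ, true_and]
    rw [hf v, if_pos hv]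
  · intro v hv
    simp only [typeClass, Finset.mem_filter, Finset.mem_univ, true_and]
    rw [hf v, if_neg hv]
  · refine herr.trans ?_
    rw [← mul_assoc]
    have hk1 : (0 : ℝ) ≤ (k : ℝ) + 1 := by positivity
    calc _ ≤ 2 * ((2 * (t * n + 1) ^ Fintype.card V * (Real.exp 1 * n) ^ Fintype.card X) ^ ρm *
            ((t * n + 1) ^ Fintype.card V) ^ 2) * Real.exp (-(n * (E + η))) := by
          gcongr
      _ ≤ Real.exp (η * n) * Real.exp (-(n * (E + η))) := by gcongr
      _ = _ := by
          rw [← Real.exp_add]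
          congr 1
          ring

end Core

section Separation

/-- The rates at which the exponent `λR + sup_{ρ ≥ 1} (e(ρ) - ρR)` does not exceed `m`. -/
def lowRates (e : ℝ → ℝ) (lam m : ℝ) : Set ℝ :=
  {R | 0 ≤ R ∧ ∀ ρ, 1 ≤ ρ → e ρ + (lam - ρ) * R ≤ m}

/-- Up to the threshold `R₀` the exponent of `a` exceeds `m`, and from there to `B` that of `b`. -/
def Splits (a b : ℝ → ℝ) (lam B R₀ m : ℝ) : Prop :=
  (∀ R, 0 ≤ R → R ≤ R₀ → ∃ ρ, 1 ≤ ρ ∧ m < a ρ + (lam - ρ) * R) ∧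
    ∀ R, R₀ < R → R ≤ B → ∃ ρ, 1 ≤ ρ ∧ m < b ρ + (lam - ρ) * R

lemma exists_lt_of_notMem_lowRates {e : ℝ → ℝ} {lam m R : ℝ} (hR : 0 ≤ R)
    (h : R ∉ lowRates e lam m) : ∃ ρ, 1 ≤ ρ ∧ m < e ρ + (lam - ρ) * R := by
  by_contra hc
  push Not at hc
  exact h ⟨hR, hc⟩

lemma lowRates_mono (e : ℝ → ℝ) (lam : ℝ) {m m' : ℝ} (h : m ≤ m') :
    lowRates e lam m ⊆ lowRates e lam m' :=
  fun _ hR => ⟨hR.1, fun ρ hρ => (hR.2 ρ hρ).trans h⟩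

lemma lowRates_between {e : ℝ → ℝ} {lam m r s r' : ℝ} (hr : r ∈ lowRates e lam m)
    (hr' : r' ∈ lowRates e lam m) (h1 : r ≤ s) (h2 : s ≤ r') : s ∈ lowRates e lam m := by
  refine ⟨hr.1.trans h1, fun ρ hρ => ?_⟩
  have ha := hr.2 ρ hρ
  have hb := hr'.2 ρ hρ
  rcases le_total 0 (lam - ρ) with h | h
  · nlinarith
  · nlinarith

lemma lowRates_add {e : ℝ → ℝ} {lam m R d : ℝ} (hd : 0 ≤ d) (hR : R ∈ lowRates e lam m) :
    R + d ∈ lowRates e lam (m + lam * d) := by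
  refine ⟨add_nonneg hR.1 hd, fun ρ hρ => ?_⟩
  have := hR.2 ρ hρ
  nlinarith

lemma forall_lt_of_ordConnected {S₁ S₂ : Set ℝ}
    (h₁ : ∀ r ∈ S₁, ∀ r' ∈ S₁, ∀ s, r ≤ s → s ≤ r' → s ∈ S₁)
    (h₂ : ∀ r ∈ S₂, ∀ r' ∈ S₂, ∀ s, r ≤ s → s ≤ r' → s ∈ S₂)
    (hdisj : ∀ r ∈ S₁, r ∉ S₂) {r₁ r₂ : ℝ} (hr₁ : r₁ ∈ S₁) (hr₂ : r₂ ∈ S₂) (h : r₁ < r₂) :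
    ∀ s₁ ∈ S₁, ∀ s₂ ∈ S₂, s₁ < s₂ := by
  intro s₁ hs₁ s₂ hs₂
  by_contra hle
  push Not at hle
  rcases le_or_gt r₂ s₁ with h3 | h3
  · exact hdisj r₂ (h₁ r₁ hr₁ s₁ hs₁ r₂ h.le h3) hr₂
  · exact hdisj s₁ hs₁ (h₂ s₂ hs₂ r₂ hr₂ s₁ hle h3.le)

lemma splits_of_lowRates_eq_empty {a b : ℝ → ℝ} {lam B m : ℝ} (h : ∀ R, R ∉ lowRates a lam m) :
    Splits a b lam B (B + 1) m :=
  ⟨fun R hR _ => exists_lt_of_notMem_lowRates hR (h R), fun R h1 h2 => by linarith⟩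

lemma exists_splits_of_lt {e₁ e₂ : ℝ → ℝ} {lam m m' : ℝ} (B : ℝ) (hlam : 0 < lam) (hm : m < m')
    (hdisj : ∀ r ∈ lowRates e₁ lam m', r ∉ lowRates e₂ lam m') {r₁ r₂ : ℝ}
    (hr₁ : r₁ ∈ lowRates e₁ lam m) (hr₂ : r₂ ∈ lowRates e₂ lam m) (h : r₁ < r₂) :
    ∃ R₀, 0 < R₀ ∧ Splits e₂ e₁ lam B R₀ m := by
  have hsub₁ := lowRates_mono e₁ lam hm.le
  have hsub₂ := lowRates_mono e₂ lam hm.le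
  have hlt := forall_lt_of_ordConnected (S₁ := lowRates e₁ lam m') (S₂ := lowRates e₂ lam m')
    (fun r hr r' hr' s => lowRates_between hr hr') (fun r hr r' hr' s => lowRates_between hr hr')
    hdisj (hsub₁ hr₁) (hsub₂ hr₂) h
  have hbdd : BddAbove (lowRates e₁ lam m) :=
    ⟨r₂, fun s hs => (hlt s (hsub₁ hs) r₂ (hsub₂ hr₂)).le⟩
  set d : ℝ := (m' - m) / lam with hd
  have hd0 : 0 < d := div_pos (by linarith) hlam
  have hsup0 : 0 ≤ sSup (lowRates e₁ lam m) := hr₁.1.trans (le_csSup hbdd hr₁)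
  refine ⟨sSup (lowRates e₁ lam m) + d / 2, by linarith, fun R hR hRle => ?_, fun R hR _ => ?_⟩
  · refine exists_lt_of_notMem_lowRates hR fun hmem => ?_
    obtain ⟨s, hs, hs'⟩ := exists_lt_of_lt_csSup ⟨r₁, hr₁⟩
      (show sSup (lowRates e₁ lam m) - d / 2 < sSup (lowRates e₁ lam m) by linarith)
    have hsd := lowRates_add hd0.le hs
    have : m + lam * d = m' := by rw [hd]; field_simp; ring
    rw [this] at hsd
    have := hlt _ hsd R (hsub₂ hmem)
    linarith
  · refine exists_lt_of_notMem_lowRates (by linarith) fun hmem => ?_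
    have := le_csSup hbdd hmem
    linarith

/-- If at every rate one of two exponents exceeds `m'`, a single threshold suffices to have the
exponent in charge exceed a given `m < m'`. -/
lemma exists_splits_or {e₁ e₂ : ℝ → ℝ} {lam m m' B : ℝ} (hB : 0 ≤ B) (hlam : 0 < lam)
    (hm : m < m') (h : ∀ R, 0 ≤ R → ∃ ρ, 1 ≤ ρ ∧
      (m' < e₁ ρ + (lam - ρ) * R ∨ m' < e₂ ρ + (lam - ρ) * R)) :
    ∃ R₀, 0 < R₀ ∧ (Splits e₁ e₂ lam B R₀ m ∨ Splits e₂ e₁ lam B R₀ m) := by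
  have hdisj : ∀ r ∈ lowRates e₁ lam m', r ∉ lowRates e₂ lam m' := by
    intro r hr₁ hr₂
    obtain ⟨ρ, hρ, h | h⟩ := h r hr₁.1
    · exact absurd (hr₁.2 ρ hρ) (not_le.2 h)
    · exact absurd (hr₂.2 ρ hρ) (not_le.2 h)
  rcases (lowRates e₁ lam m).eq_empty_or_nonempty with h₁ | ⟨r₁, hr₁⟩
  · exact ⟨B + 1, by linarith, Or.inl (splits_of_lowRates_eq_empty fun R hR => by simp [h₁] at hR)⟩
  rcases (lowRates e₂ lam m).eq_empty_or_nonempty with h₂ | ⟨r₂, hr₂⟩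
  · exact ⟨B + 1, by linarith, Or.inr (splits_of_lowRates_eq_empty fun R hR => by simp [h₂] at hR)⟩
  rcases lt_trichotomy r₁ r₂ with hlt | heq | hlt
  · obtain ⟨R₀, h0, hs⟩ := exists_splits_of_lt B hlam hm hdisj hr₁ hr₂ hlt
    exact ⟨R₀, h0, Or.inr hs⟩
  · subst heq
    exact absurd (lowRates_mono e₂ lam hm.le hr₂) (hdisj r₁ (lowRates_mono e₁ lam hm.le hr₁))
  · obtain ⟨R₀, h0, hs⟩ := exists_splits_of_lt B hlam hm (fun r h2 h1 => hdisj r h1 h2) hr₂ hr₁ hlt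
    exact ⟨R₀, h0, Or.inl hs⟩

lemma exists_forall_splits_of_lt {e₁ e₂ : ℝ → ℝ} {lam m D : ℝ} (B : ℝ) (hlam : 0 < lam)
    (hD : ∀ ρ, 1 ≤ ρ → e₂ ρ ≤ D)
    (hdisj : ∀ m' < m, ∀ r ∈ lowRates e₁ lam m', r ∉ lowRates e₂ lam m') {r₁ r₂ m₁ m₂ : ℝ}
    (hm₁ : m₁ < m) (hm₂ : m₂ < m)
    (hr₁ : r₁ ∈ lowRates e₁ lam m₁) (hr₂ : r₂ ∈ lowRates e₂ lam m₂) (h : r₁ < r₂) :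
    ∃ R₀, 0 < R₀ ∧ ∀ m' < m, Splits e₂ e₁ lam B R₀ m' := by
  let S : (ℝ → ℝ) → Set ℝ := fun e => {R | ∃ m' < m, R ∈ lowRates e lam m'}
  have hconn : ∀ e, ∀ r ∈ S e, ∀ r' ∈ S e, ∀ s, r ≤ s → s ≤ r' → s ∈ S e := by
    rintro e r ⟨a, ha, hra⟩ r' ⟨b, hb, hrb⟩ s h1 h2
    exact ⟨max a b, max_lt ha hb, lowRates_between (lowRates_mono e lam (le_max_left _ _) hra)
      (lowRates_mono e lam (le_max_right _ _) hrb) h1 h2⟩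
  have hdisjS : ∀ r ∈ S e₁, r ∉ S e₂ := by
    rintro r ⟨a, ha, hra⟩ ⟨b, hb, hrb⟩
    exact hdisj (max a b) (max_lt ha hb) r (lowRates_mono e₁ lam (le_max_left _ _) hra)
      (lowRates_mono e₂ lam (le_max_right _ _) hrb)
  have hS₁ : r₁ ∈ S e₁ := ⟨m₁, hm₁, hr₁⟩
  have hS₂ : r₂ ∈ S e₂ := ⟨m₂, hm₂, hr₂⟩
  have hlt := forall_lt_of_ordConnected (hconn e₁) (hconn e₂) hdisjS hS₁ hS₂ h
  have hbdd : BddAbove (S e₁) := ⟨r₂, fun s hs => (hlt s hs r₂ hS₂).le⟩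
  have hpos : 0 < sSup (S e₁) := by
    set d : ℝ := (m - m₁) / 2 / lam with hd
    have hd0 : 0 < d := div_pos (by linarith) hlam
    have hmem : r₁ + d ∈ S e₁ := by
      refine ⟨m₁ + lam * d, ?_, lowRates_add hd0.le hr₁⟩
      have : lam * d = (m - m₁) / 2 := by rw [hd]; field_simp
      linarith
    have := le_csSup hbdd hmem
    have := hr₁.1
    linarith
  refine ⟨sSup (S e₁), hpos, fun m' hm' => ⟨fun R hR hRle => ?_, fun R hR _ => ?_⟩⟩
  · refine exists_lt_of_notMem_lowRates hR fun hmem => ?_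
    have hRpos : 0 < R := hpos.trans_le
      (csSup_le ⟨r₁, hS₁⟩ fun s hs => (hlt s hs R ⟨m', hm', hmem⟩).le)
    obtain ⟨θ, hθ0, hθ1, hθ⟩ : ∃ θ : ℝ, 0 < θ ∧ θ ≤ 1 ∧ (1 - θ) * m' + θ * D < m := by
      have hden : 0 < |D - m'| + 1 := by positivity
      refine ⟨min 1 ((m - m') / 2 / (|D - m'| + 1)), lt_min one_pos
        (div_pos (by linarith) hden), min_le_left _ _, ?_⟩
      set θ := min 1 ((m - m') / 2 / (|D - m'| + 1))
      have h1 : θ ≤ (m - m') / 2 / (|D - m'| + 1) := min_le_right _ _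
      have h0 : 0 < θ := lt_min one_pos (div_pos (by linarith) hden)
      rw [le_div_iff₀ hden] at h1
      have h2 : θ * (D - m') ≤ θ * (|D - m'| + 1) := by
        gcongr
        linarith [le_abs_self (D - m')]
      nlinarith
    have hmem' : (1 - θ) * R ∈ S e₂ := by
      refine ⟨(1 - θ) * m' + θ * D, hθ, mul_nonneg (by linarith) hR, fun ρ hρ => ?_⟩
      have h1 := hmem.2 ρ hρ
      have h2 := hD ρ hρ
      calc e₂ ρ + (lam - ρ) * ((1 - θ) * R)
          = (1 - θ) * (e₂ ρ + (lam - ρ) * R) + θ * e₂ ρ := by ring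
        _ ≤ _ := add_le_add (mul_le_mul_of_nonneg_left h1 (by linarith))
            (mul_le_mul_of_nonneg_left h2 hθ0.le)
    have h3 : sSup (S e₁) ≤ (1 - θ) * R :=
      csSup_le ⟨r₁, hS₁⟩ fun s hs => (hlt s hs _ hmem').le
    nlinarith
  · refine exists_lt_of_notMem_lowRates (by linarith) fun hmem => ?_
    have := le_csSup hbdd (show R ∈ S e₁ from ⟨m', hm', hmem⟩)
    linarith

/-- For bounded exponents one threshold serves all `m' < m`. -/
lemma exists_forall_splits_or {e₁ e₂ : ℝ → ℝ} {lam m B D : ℝ} (hB : 0 ≤ B) (hlam : 0 < lam)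
    (hD₁ : ∀ ρ, 1 ≤ ρ → e₁ ρ ≤ D) (hD₂ : ∀ ρ, 1 ≤ ρ → e₂ ρ ≤ D)
    (h : ∀ m' < m, ∀ R, 0 ≤ R → ∃ ρ, 1 ≤ ρ ∧
      (m' < e₁ ρ + (lam - ρ) * R ∨ m' < e₂ ρ + (lam - ρ) * R)) :
    ∃ R₀, 0 < R₀ ∧
      ((∀ m' < m, Splits e₁ e₂ lam B R₀ m') ∨ (∀ m' < m, Splits e₂ e₁ lam B R₀ m')) := by
  have hdisj : ∀ m' < m, ∀ r ∈ lowRates e₁ lam m', r ∉ lowRates e₂ lam m' := by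
    intro m' hm' r hr₁ hr₂
    obtain ⟨ρ, hρ, h | h⟩ := h m' hm' r hr₁.1
    · exact absurd (hr₁.2 ρ hρ) (not_le.2 h)
    · exact absurd (hr₂.2 ρ hρ) (not_le.2 h)
  by_cases h₁ : ∀ m' < m, ∀ R, R ∉ lowRates e₁ lam m'
  · exact ⟨B + 1, by linarith, Or.inl fun m' hm' => splits_of_lowRates_eq_empty (h₁ m' hm')⟩
  by_cases h₂ : ∀ m' < m, ∀ R, R ∉ lowRates e₂ lam m'
  · exact ⟨B + 1, by linarith, Or.inr fun m' hm' => splits_of_lowRates_eq_empty (h₂ m' hm')⟩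
  push Not at h₁ h₂
  obtain ⟨m₁, hm₁, r₁, hr₁⟩ := h₁
  obtain ⟨m₂, hm₂, r₂, hr₂⟩ := h₂
  rcases lt_trichotomy r₁ r₂ with hlt | heq | hlt
  · obtain ⟨R₀, h0, hs⟩ := exists_forall_splits_of_lt B hlam hD₂ hdisj hm₁ hm₂ hr₁ hr₂ hlt
    exact ⟨R₀, h0, Or.inr hs⟩
  · subst heq
    exact absurd (lowRates_mono e₂ lam (le_max_right m₁ m₂) hr₂)
      (hdisj _ (max_lt hm₁ hm₂) r₁ (lowRates_mono e₁ lam (le_max_left m₁ m₂) hr₁))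
  · obtain ⟨R₀, h0, hs⟩ := exists_forall_splits_of_lt B hlam hD₁
      (fun m' hm' r h2 h1 => hdisj m' hm' r h1 h2) hm₂ hm₁ hr₂ hr₁ hlt
    exact ⟨R₀, h0, Or.inl hs⟩

end Separation

section Dual

variable {V X Y : Type*} [Fintype V] [Fintype X] [Fintype Y]

lemma exists_of_lt_EJexDual {PV : V → ℝ} {W : X → Y → ℝ} (hW : ∀ x, W x ∈ stdSimplex ℝ Y)
    {t : ℝ} {Q₁ Q₂ : X → ℝ} (hQ₁ : Q₁ ∈ stdSimplex ℝ X) (hQ₂ : Q₂ ∈ stdSimplex ℝ X) {E : ℝ}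
    (hE : (E : EReal) < EJexDual PV W t {Q₁, Q₂}) :
    ∃ lam, 1 ≤ lam ∧ ∃ m', E + t * Es PV lam < m' ∧ ∀ R, 0 ≤ R → ∃ ρ, 1 ≤ ρ ∧
      (m' < exReal W Q₁ ρ + (lam - ρ) * R ∨ m' < exReal W Q₂ ρ + (lam - ρ) * R) := by
  unfold EJexDual at hE
  simp only [lt_iSup_iff] at hE
  obtain ⟨lam, hlam, hE⟩ := hE
  rw [EReal.lt_sub_iff_add_lt (Or.inr (EReal.coe_ne_top _)) (Or.inr (EReal.coe_ne_bot _)),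
    ← EReal.coe_add] at hE
  obtain ⟨m', hm1, hm2⟩ := EReal.lt_iff_exists_real_btwn.1 hE
  refine ⟨lam, hlam, m', by exact_mod_cast hm1, fun R hR => ?_⟩
  have h1 : (m' : EReal) < _ := hm2.trans_le (iInf₂_le R (Set.mem_Ici.2 hR))
  simp only [lt_iSup_iff] at h1
  obtain ⟨ρ, hρ, h1⟩ := h1
  have hρ1 : 1 ≤ ρ := hρ
  refine ⟨ρ, hρ1, ?_⟩
  rw [iSup_pair, ← coe_exReal hW hQ₁ (by linarith), ← coe_exReal hW hQ₂ (by linarith)] at h1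
  rcases le_total (exReal W Q₁ ρ) (exReal W Q₂ ρ) with h | h
  · right
    rw [max_eq_right (EReal.coe_le_coe_iff.2 h)] at h1
    exact_mod_cast h1
  · left
    rw [max_eq_left (EReal.coe_le_coe_iff.2 h)] at h1
    exact_mod_cast h1

lemma TwoClassAttains.mono {PV : V → ℝ} {W : X → Y → ℝ} {t : ℝ} {Qa Qb : X → ℝ} {R₀ E E' : ℝ}
    (h : TwoClassAttains PV W t Qa Qb R₀ E) (hE : E' ≤ E) :
    TwoClassAttains PV W t Qa Qb R₀ E' := by
  intro δ hδ
  obtain ⟨n₀, hn₀⟩ := h δ hδ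
  refine ⟨n₀, fun n hn => ?_⟩
  obtain ⟨Qa', Qb', h1, h2, h3, h4, f, φ, h5, h6, h7⟩ := hn₀ n hn
  refine ⟨Qa', Qb', h1, h2, h3, h4, f, φ, h5, h6, h7.trans (Real.exp_le_exp.2 ?_)⟩
  have : (n : ℝ) * E' ≤ n * E := by gcongr
  linarith

lemma twoClassAttains_of_splits {PV : V → ℝ} (hPV : PV ∈ stdSimplex ℝ V)
    {W : X → Y → ℝ} (hW : ∀ x, W x ∈ stdSimplex ℝ Y) {t : ℝ} (ht : 0 < t) {Qa Qb : X → ℝ}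
    (hQa : Qa ∈ stdSimplex ℝ X) (hQb : Qb ∈ stdSimplex ℝ X) {R₀ E lam m : ℝ}
    (hlam : 0 < lam) (hE : E + t * Es PV lam < m)
    (h : Splits (exReal W Qa) (exReal W Qb) lam (t * Real.log (Fintype.card V)) R₀ m) :
    TwoClassAttains PV W t Qa Qb R₀ E :=
  twoClassAttains_of_forall_exists hPV hW ht hQa hQb hlam (by linarith) h.1 h.2

open Filter in
/-- A source concentrated on one letter is transmitted without error. -/
lemma twoClassAttains_of_deterministic {PV : V → ℝ} (hPV : PV ∈ stdSimplex ℝ V) {v₀ : V}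
    (hv₀ : PV v₀ = 1) (W : X → Y → ℝ) (t : ℝ) {Qa Qb : X → ℝ}
    (hQa : Qa ∈ stdSimplex ℝ X) (hQb : Qb ∈ stdSimplex ℝ X) (R₀ E : ℝ) :
    TwoClassAttains PV W t Qa Qb R₀ E := by
  classical
  intro δ hδ
  rw [← eventually_atTop]
  filter_upwards [eventually_exists_empDist_approx hQa hδ one_pos,
    eventually_exists_empDist_approx hQb hδ one_pos] with n hna hnb
  obtain ⟨xa, hxa, -⟩ := hna
  obtain ⟨xb, hxb, -⟩ := hnb
  refine ⟨empDist xa, empDist xb, ⟨xa, rfl⟩, ⟨xb, rfl⟩, hxa, hxb,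
    fun v => if v ∈ lowClass V _ n R₀ then xa else xb, fun _ _ => v₀, ?_, ?_, ?_⟩
  · intro v hv
    simp [typeClass, hv]
  · intro v hv
    simp [typeClass, hv]
  · refine le_trans (le_of_eq ?_) (Real.exp_pos _).le
    unfold pErr
    refine Finset.sum_eq_zero fun v _ => ?_
    by_cases hv : v = fun _ => v₀
    · subst hv
      simp
    · obtain ⟨i, hi⟩ : ∃ i, v i ≠ v₀ := by
        by_contra hc
        push Not at hc
        exact hv (funext hc)
      have hzero : PV (v i) = 0 := by
        have h1 := Finset.add_sum_erase Finset.univ PV (Finset.mem_univ v₀)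
        rw [hPV.2, hv₀] at h1
        have h2 := Finset.single_le_sum (f := PV) (fun u _ => hPV.1 u)
          (Finset.mem_erase.2 ⟨hi, Finset.mem_univ (v i)⟩)
        linarith [hPV.1 (v i)]
      rw [prodDist, Finset.prod_eq_zero (Finset.mem_univ i) hzero, zero_mul]

lemma exists_pos_mul_le_Es {PV : V → ℝ} (hPV : PV ∈ stdSimplex ℝ V) (hne : ∀ v, PV v ≠ 1) :
    ∃ c, 0 < c ∧ ∀ lam, 1 ≤ lam → c * lam ≤ Es PV lam := by
  have hle1 : ∀ v, PV v ≤ 1 := fun v =>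
    hPV.2 ▸ Finset.single_le_sum (fun u _ => hPV.1 u) (Finset.mem_univ v)
  have hmono : ∀ v, ∀ s : ℝ, 0 < s → s ≤ 1 / 2 → PV v ^ (1 / 2 : ℝ) ≤ PV v ^ s := by
    intro v s hs hs'
    rcases (hPV.1 v).eq_or_lt with h | h
    · rw [← h, Real.zero_rpow hs.ne', Real.zero_rpow (by norm_num)]
    · exact Real.rpow_le_rpow_of_exponent_ge h (hle1 v) hs'
  have hA : 1 < ∑ v, PV v ^ (1 / 2 : ℝ) := by
    suffices h : ∑ v, PV v < ∑ v, PV v ^ (1 / 2 : ℝ) by rwa [hPV.2] at h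
    obtain ⟨v, -, hv⟩ : ∃ v ∈ Finset.univ, PV v ≠ 0 := by
      apply Finset.exists_ne_zero_of_sum_ne_zero
      rw [hPV.2]
      exact one_ne_zero
    have hv0 : 0 < PV v := lt_of_le_of_ne (hPV.1 v) (Ne.symm hv)
    refine Finset.sum_lt_sum (fun u _ => ?_) ⟨v, Finset.mem_univ v, ?_⟩
    · rcases (hPV.1 u).eq_or_lt with h | h
      · rw [← h, Real.zero_rpow (by norm_num)]
      · simpa using Real.rpow_le_rpow_of_exponent_ge h (hle1 u) (by norm_num : (1 / 2 : ℝ) ≤ 1)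
    · simpa using Real.rpow_lt_rpow_of_exponent_gt hv0 (lt_of_le_of_ne (hle1 v) (hne v))
        (by norm_num : (1 / 2 : ℝ) < 1)
  refine ⟨Real.log (∑ v, PV v ^ (1 / 2 : ℝ)), Real.log_pos hA, fun lam hlam => ?_⟩
  have hlog := Real.log_pos hA
  unfold Es
  have h2 : Real.log (∑ v, PV v ^ (1 / 2 : ℝ)) ≤ Real.log (∑ v, PV v ^ (1 / (1 + lam))) := by
    refine Real.log_le_log (by linarith) (Finset.sum_le_sum fun v _ => hmono v _ (by positivity) ?_)
    exact one_div_le_one_div_of_le (by norm_num) (by linarith)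
  nlinarith

lemma continuousAt_Es {PV : V → ℝ} (hPV : PV ∈ stdSimplex ℝ V) {lam : ℝ} (hlam : 0 ≤ lam) :
    ContinuousAt (Es PV) lam := by
  have h0 : (1 : ℝ) + lam ≠ 0 := by linarith
  have hin : ContinuousAt (fun ρ : ℝ => 1 / (1 + ρ)) lam :=
    continuousAt_const.div (by fun_prop) h0
  have hsum : ContinuousAt (fun ρ : ℝ => ∑ v, PV v ^ (1 / (1 + ρ))) lam := by
    refine tendsto_finsetSum _ fun v _ => ?_
    exact ContinuousAt.comp (g := fun s : ℝ => PV v ^ s) (f := fun ρ : ℝ => 1 / (1 + ρ))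
      (Real.continuousAt_const_rpow' (one_div_ne_zero h0)) hin
  unfold Es
  refine ContinuousAt.mul (by fun_prop) (hsum.log ?_)
  have : (1 : ℝ) ≤ ∑ v, PV v ^ (1 / (1 + lam)) :=
    one_le_sum_rpow hPV (by rw [div_le_one (by linarith)]; linarith) (by positivity)
  linarith

open Filter Topology in
/-- For bounded exponents and a non-degenerate source the supremum over `λ` is attained. -/
lemma exists_optimal_lam {PV : V → ℝ} (hPV : PV ∈ stdSimplex ℝ V) (hne : ∀ v, PV v ≠ 1) {t : ℝ}
    (ht : 0 < t) {e₁ e₂ : ℝ → ℝ} {D J : ℝ} (hD₁ : ∀ ρ, 1 ≤ ρ → e₁ ρ ≤ D)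
    (hD₂ : ∀ ρ, 1 ≤ ρ → e₂ ρ ≤ D)
    (h : ∀ E < J, ∃ lam, 1 ≤ lam ∧ ∀ R, 0 ≤ R → ∃ ρ, 1 ≤ ρ ∧
      (E + t * Es PV lam < e₁ ρ + (lam - ρ) * R ∨ E + t * Es PV lam < e₂ ρ + (lam - ρ) * R)) :
    ∃ lam, 1 ≤ lam ∧ ∀ m' < J + t * Es PV lam, ∀ R, 0 ≤ R → ∃ ρ, 1 ≤ ρ ∧
      (m' < e₁ ρ + (lam - ρ) * R ∨ m' < e₂ ρ + (lam - ρ) * R) := by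
  have hEj : ∀ j : ℕ, J - 1 / ((j : ℝ) + 1) < J := fun j => by
    have : (0 : ℝ) < 1 / ((j : ℝ) + 1) := by positivity
    linarith
  choose lam hlam1 hlam using fun j => h _ (hEj j)
  obtain ⟨c, hc, hEs⟩ := exists_pos_mul_le_Es hPV hne
  have hbound : ∀ j, lam j ∈ Set.Icc 1 ((D - J + 1) / (t * c)) := by
    intro j
    refine ⟨hlam1 j, ?_⟩
    have h1 : (1 : ℝ) / ((j : ℝ) + 1) ≤ 1 := by
      rw [div_le_one (by positivity)]; linarith [Nat.cast_nonneg (α := ℝ) j]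
    have h2 : J - 1 / ((j : ℝ) + 1) + t * Es PV (lam j) < D := by
      obtain ⟨ρ, hρ, h | h⟩ := hlam j 0 le_rfl
      · have := hD₁ ρ hρ; linarith
      · have := hD₂ ρ hρ; linarith
    have h3 := mul_le_mul_of_nonneg_left (hEs (lam j) (hlam1 j)) ht.le
    rw [le_div_iff₀ (mul_pos ht hc)]
    nlinarith
  obtain ⟨lam₀, hlam₀, φ, hφ, hlim⟩ := isCompact_Icc.tendsto_subseq hbound
  refine ⟨lam₀, hlam₀.1, fun m' hm' R hR => ?_⟩
  have hlim0 : Tendsto (fun j => (1 : ℝ) / ((φ j : ℝ) + 1)) atTop (𝓝 0) :=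
    tendsto_one_div_add_atTop_nhds_zero_nat.comp hφ.tendsto_atTop
  have hEslim : Tendsto (fun j => Es PV (lam (φ j))) atTop (𝓝 (Es PV lam₀)) :=
    (continuousAt_Es hPV (by linarith [hlam₀.1])).tendsto.comp hlim
  have hlimR : Tendsto (fun j => J - 1 / ((φ j : ℝ) + 1) + t * Es PV (lam (φ j)) - lam (φ j) * R)
      atTop (𝓝 (J - 0 + t * Es PV lam₀ - lam₀ * R)) :=
    ((tendsto_const_nhds.sub hlim0).add (hEslim.const_mul t)).sub (hlim.mul_const R)
  have hev := hlimR.eventually (lt_mem_nhds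
    (show m' - lam₀ * R < J - 0 + t * Es PV lam₀ - lam₀ * R by linarith))
  obtain ⟨j, hj⟩ := hev.exists
  obtain ⟨ρ, hρ, h | h⟩ := hlam (φ j) R hR
  · exact ⟨ρ, hρ, Or.inl (by linarith)⟩
  · exact ⟨ρ, hρ, Or.inr (by linarith)⟩

end Dual

end

theorem stmt10 {V X Y : Type*} [Fintype V] [Fintype X] [Fintype Y]
    (PV : V → ℝ) (hPV : PV ∈ stdSimplex ℝ V)
    (W : X → Y → ℝ) (hW : ∀ x, W x ∈ stdSimplex ℝ Y)
    (t : ℝ) (ht : 0 < t)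
    (Q₁ Q₂ : X → ℝ) (hQ₁ : Q₁ ∈ stdSimplex ℝ X) (hQ₂ : Q₂ ∈ stdSimplex ℝ X) :
    ((∀ Q ∈ ({Q₁, Q₂} : Set (X → ℝ)), ∃ x', ∀ x, Q x ≠ 0 → dB W x x' ≠ ⊤) →
      ∃ R₀ : ℝ, 0 < R₀ ∧
        ((∀ E : ℝ, (E : EReal) < EJexDual PV W t {Q₁, Q₂} →
            TwoClassAttains PV W t Q₁ Q₂ R₀ E) ∨
          (∀ E : ℝ, (E : EReal) < EJexDual PV W t {Q₁, Q₂} →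
            TwoClassAttains PV W t Q₂ Q₁ R₀ E))) ∧
    ((∀ E : ℝ, (E : EReal) < EJexDual PV W t {Q₁, Q₂} →
        ∃ R₀ : ℝ, 0 < R₀ ∧ TwoClassAttains PV W t Q₁ Q₂ R₀ E) ∨
      (∀ E : ℝ, (E : EReal) < EJexDual PV W t {Q₁, Q₂} →
        ∃ R₀ : ℝ, 0 < R₀ ∧ TwoClassAttains PV W t Q₂ Q₁ R₀ E)) := by
  have hVne : Nonempty V := by
    by_contra h
    rw [not_nonempty_iff] at h
    simpa using hPV.2
  have hB : 0 ≤ t * Real.log (Fintype.card V) :=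
    mul_nonneg ht.le (Real.log_nonneg (by exact_mod_cast Fintype.card_pos))
  constructor
  · intro hfin
    by_cases hdet : ∃ v, PV v = 1
    · obtain ⟨v₀, hv₀⟩ := hdet
      exact ⟨1, one_pos, Or.inl fun E _ =>
        twoClassAttains_of_deterministic hPV hv₀ W t hQ₁ hQ₂ 1 E⟩
    push Not at hdet
    obtain ⟨x₁, hx₁⟩ := hfin Q₁ (by simp)
    obtain ⟨x₂, hx₂⟩ := hfin Q₂ (by simp)
    obtain ⟨D, hD₁, hD₂⟩ : ∃ D, (∀ ρ, 1 ≤ ρ → exReal W Q₁ ρ ≤ D) ∧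
        ∀ ρ, 1 ≤ ρ → exReal W Q₂ ρ ≤ D :=
      ⟨max _ _, fun ρ hρ => (exReal_le_of_bhatt_pos hW hQ₁ (fun x hx =>
          bhatt_pos_of_dB_ne_top (hx₁ x hx)) (by linarith)).trans (le_max_left _ _),
        fun ρ hρ => (exReal_le_of_bhatt_pos hW hQ₂ (fun x hx =>
          bhatt_pos_of_dB_ne_top (hx₂ x hx)) (by linarith)).trans (le_max_right _ _)⟩
    have hDlt : ∀ E : ℝ, (E : EReal) < EJexDual PV W t {Q₁, Q₂} → E < D := by
      intro E hE
      obtain ⟨lam, hlam, m', hm', hR⟩ := exists_of_lt_EJexDual hW hQ₁ hQ₂ hE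
      have hEs := mul_nonneg ht.le (Es_nonneg hPV (lam := lam) (by linarith))
      obtain ⟨ρ, hρ, h | h⟩ := hR 0 le_rfl
      · have := hD₁ ρ hρ; linarith
      · have := hD₂ ρ hρ; linarith
    induction hJ : EJexDual PV W t {Q₁, Q₂} with
    | bot => exact ⟨1, one_pos, Or.inl fun E hE => absurd hE not_lt_bot⟩
    | top =>
      have := hDlt D (by rw [hJ]; exact EReal.coe_lt_top D)
      exact absurd this (lt_irrefl _)
    | coe J =>
      obtain ⟨lam, hlam, hlamJ⟩ := exists_optimal_lam hPV hdet ht hD₁ hD₂ (J := J) (by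
        intro E hE
        obtain ⟨lam, hlam, m', hm', hR⟩ := exists_of_lt_EJexDual hW hQ₁ hQ₂
          (E := E) (by rw [hJ]; exact_mod_cast hE)
        refine ⟨lam, hlam, fun R h0 => ?_⟩
        obtain ⟨ρ, hρ, h⟩ := hR R h0
        exact ⟨ρ, hρ, h.imp hm'.trans hm'.trans⟩)
      have hlam0 : 0 < lam := by linarith
      obtain ⟨R₀, hR₀, hsplit⟩ := exists_forall_splits_or hB hlam0 hD₁ hD₂ hlamJ
      refine ⟨R₀, hR₀, hsplit.imp (fun hs E hE => ?_) (fun hs E hE => ?_)⟩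
      all_goals
        have hE' : E < J := by exact_mod_cast hE
        obtain ⟨m', h1, h2⟩ := exists_between
          (show E + t * Es PV lam < J + t * Es PV lam by linarith)
      · exact twoClassAttains_of_splits hPV hW ht hQ₁ hQ₂ hlam0 h1 (hs m' h2)
      · exact twoClassAttains_of_splits hPV hW ht hQ₂ hQ₁ hlam0 h1 (hs m' h2)
  · have hkey : ∀ E : ℝ, (E : EReal) < EJexDual PV W t {Q₁, Q₂} → ∃ R₀ : ℝ, 0 < R₀ ∧
        (TwoClassAttains PV W t Q₁ Q₂ R₀ E ∨ TwoClassAttains PV W t Q₂ Q₁ R₀ E) := by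
      intro E hE
      obtain ⟨lam, hlam, m', hm', hR⟩ := exists_of_lt_EJexDual hW hQ₁ hQ₂ hE
      have hlam0 : 0 < lam := by linarith
      obtain ⟨m, h1, h2⟩ := exists_between hm'
      obtain ⟨R₀, hR₀, hs⟩ := exists_splits_or hB hlam0 h2 hR
      exact ⟨R₀, hR₀, hs.imp (twoClassAttains_of_splits hPV hW ht hQ₁ hQ₂ hlam0 h1)
        (twoClassAttains_of_splits hPV hW ht hQ₂ hQ₁ hlam0 h1)⟩
    by_contra hcon
    push Not at hcon
    obtain ⟨⟨E₁, hE₁, h₁⟩, E₂, hE₂, h₂⟩ := hcon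
    obtain ⟨R₀, hR₀, h | h⟩ := hkey (max E₁ E₂) (by
      rcases max_choice E₁ E₂ with h | h <;> rw [h] <;> assumption)
    · exact h₁ R₀ hR₀ (h.mono (le_max_left _ _))
    · exact h₂ R₀ hR₀ (h.mono (le_max_right _ _))
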